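/- arXiv:2303.10458 — 2 statements merged into one kernel-verified Lean document; each statement's English description precedes it below -/
import Mathlib

section
/- Let M = M[U,L] be a lattice path matroid and let Δ_M be the alcoved triangulation of its matroid polytope P_M; its maximal simplices are indexed by pairs (S, ℒ) where S is a snake inside M and ℒ is a labelling of S. Two simplices form an edge of the dual graph G_{Δ_M} if and only if one of the following holds: (i) (same snake) they are indexed by (S, ℒ) and (S, ℒ′) where ℒ and ℒ′ differ by swapping two labels (i.e., the induced linear extensions of the fence of S differ by one adjacent transposition); (ii) (between snakes) they are indexed by (S, ℒ) and (S′, ℒ′) with S ≠ S′, and one of them, say (S, ℒ), can be transformed into (S′, ℒ′) as follows: moving the box of S labelled 1 one unit up and then one unit left produces the snake S′, with the label i of ℒ corresponding to the label i−1 of ℒ′ for i ≥ 2, and the label 1 corresponding to the largest label of ℒ′. -/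
/-!
Statement 15: Description of the edges of the dual graph of the alcoved triangulation
of the base polytope of a lattice path matroid `M = M[U,L]`.  The maximal simplices are
indexed by pairs `(S, ℒ)` of a snake `S` inside `M` (encoded by its cell heights `y`)
together with a labelling `ℒ` of `S` (encoded by a bijection `lab`, a linear extension
of the fence of `S`).  Two simplices share a facet iff either they lie in the same
snake and their labellings differ by one adjacent transposition of labels, or they lie
in different snakes and one is obtained from the other by moving the box labelled `1`
one unit up and one unit left, cyclically shifting the labels.
-/

/-- The height of the lattice path associated to `A ⊆ [n]` after `i` steps. -/
def pathHeight {n : ℕ} (A : Finset (Fin n)) (i : ℕ) : ℕ :=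
  (A.filter fun j => j.val < i).card

/-- `y` encodes a snake inside the lattice path matroid `M[U,L]` of the same rank:
`y j` is the height of the unique cell of the snake on the `(j+1)`-st antidiagonal,
each cell lies in the diagram of `M[U,L]`, and the snake reaches the full rank. -/
def SnakeInside {n : ℕ} (U L : Finset (Fin n)) (y : ℕ → ℕ) : Prop :=
  y 0 = 0 ∧
  (∀ j : ℕ, j + 1 ≤ n - 2 → (y (j + 1) = y j ∨ y (j + 1) = y j + 1)) ∧
  (∀ j : ℕ, j ≤ n - 2 → pathHeight L (j + 1) ≤ y j ∧ y j + 1 ≤ pathHeight U (j + 1)) ∧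
  y (n - 2) + 1 = U.card

/-- `lab` encodes a labelling of the snake `y` on `[n]`: a bijection of the cells onto
the labels `{0, …, n-2}` increasing bottom-to-top in columns and right-to-left in rows
(equivalently, a linear extension of the fence of the snake). -/
def IsSnakeLabelling (n : ℕ) (y lab : ℕ → ℕ) : Prop :=
  Set.BijOn lab (Set.Iio (n - 1)) (Set.Iio (n - 1)) ∧
  ∀ j : ℕ, j + 1 ≤ n - 2 →
    ((y (j + 1) = y j + 1 → lab j < lab (j + 1)) ∧
     (y (j + 1) = y j → lab (j + 1) < lab j))

/-- The height, after `i` steps, of the lattice path `B_{t+1}` obtained from the lower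
path of the snake `y` by flipping the boxes with (0-based) labels `< t`. -/
def flipHt (n : ℕ) (y lab : ℕ → ℕ) (t i : ℕ) : ℕ :=
  if i = 0 then 0
  else if i ≤ n - 1 then y (i - 1) + (if lab (i - 1) < t then 1 else 0)
  else y (n - 2) + 1

/-- The vertex `B_{t+1}` of the simplex indexed by `(y, lab)`, as a 0/1 vector. -/
def flipVertex (n : ℕ) (y lab : ℕ → ℕ) (t : ℕ) : Fin n → ℝ :=
  fun i => (flipHt n y lab t (i.val + 1) : ℝ) - (flipHt n y lab t i.val : ℝ)

/-- The maximal simplex of the alcoved triangulation of `P_M` indexed by the pair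
`(S, ℒ) = (y, lab)`. -/
noncomputable def snakeSimplex (n : ℕ) (y lab : ℕ → ℕ) : Set (Fin n → ℝ) :=
  convexHull ℝ {v | ∃ t : ℕ, t < n ∧ v = flipVertex n y lab t}

/-- Two simplices of a triangulation share a facet: they are distinct and their
intersection has affine dimension one less than theirs. -/
def SharesFacet {n : ℕ} (A B : Set (Fin n → ℝ)) : Prop :=
  A ≠ B ∧
    Module.finrank ℝ ↥(vectorSpan ℝ (A ∩ B)) + 1 = Module.finrank ℝ ↥(vectorSpan ℝ A)

/-- The labellings `lab` and `lab'` (of the same snake) differ by swapping the two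
labels `t` and `t + 1` (an adjacent transposition of the induced linear extensions). -/
def DifferBySwap (n : ℕ) (lab lab' : ℕ → ℕ) : Prop :=
  (∃ t : ℕ, ∀ j : ℕ, j < n - 1 →
      lab' j = if lab j = t then t + 1 else if lab j = t + 1 then t else lab j) ∧
  ∃ j : ℕ, j < n - 1 ∧ lab' j ≠ lab j

/-- `(y', lab')` is obtained from `(y, lab)` by moving the box labelled `1` (0-based
label `0`) one unit up and then one unit left: the moved box keeps its antidiagonal and
its height increases by one, it receives the largest label, and every other label is
decreased by one. -/
def MoveBoxOne (n : ℕ) (y lab y' lab' : ℕ → ℕ) : Prop :=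
  ∃ j₀ : ℕ, j₀ < n - 1 ∧ lab j₀ = 0 ∧
    (∀ j : ℕ, j ≤ n - 2 → y' j = if j = j₀ then y j + 1 else y j) ∧
    (∀ j : ℕ, j < n - 1 → lab' j = if j = j₀ then n - 2 else lab j - 1)

/-- The height function of a vector: the sum of its first `j` coordinates. -/
def prefixSum {n : ℕ} (j : ℕ) (v : Fin n → ℝ) : ℝ :=
  ∑ i : Fin n, if i.val < j then v i else 0

theorem prefixSum_sum_smul {n : ℕ} {ι : Type*} [Fintype ι] (j : ℕ) (w : ι → ℝ)
    (V : ι → Fin n → ℝ) :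
    prefixSum j (∑ t, w t • V t) = ∑ t, w t * prefixSum j (V t) := by
  simp only [prefixSum, Finset.sum_apply, Pi.smul_apply, smul_eq_mul, Finset.mul_sum, mul_ite,
    mul_zero]
  rw [Finset.sum_comm]
  refine Finset.sum_congr rfl fun i _ => ?_
  split_ifs <;> simp

theorem prefixSum_flipVertex {n : ℕ} (y lab : ℕ → ℕ) (t : ℕ) {j : ℕ} (hj : j ≤ n) :
    prefixSum j (flipVertex n y lab t) = flipHt n y lab t j := by
  have h0 : flipHt n y lab t 0 = 0 := by simp [flipHt]
  unfold prefixSum flipVertex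
  rw [Fin.sum_univ_eq_sum_range (fun i => if i < j then
    (flipHt n y lab t (i + 1) : ℝ) - flipHt n y lab t i else 0) n, ← Finset.sum_filter]
  have hf : (Finset.range n).filter (fun i => i < j) = Finset.range j := by
    ext i; simp only [Finset.mem_filter, Finset.mem_range]; omega
  rw [hf, Finset.sum_range_sub (fun i => (flipHt n y lab t i : ℝ)), h0]
  simp

theorem flipHt_succ {n : ℕ} (y lab : ℕ → ℕ) (t : ℕ) {j : ℕ} (hj : j < n - 1) :
    flipHt n y lab t (j + 1) = y j + if lab j < t then 1 else 0 := by
  simp [flipHt, Nat.succ_le_of_lt hj]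

/-- The vertices `t` of `(y, lab)` and `s` of `(y', lab')` have the same heights. -/
def FlipMatch (n : ℕ) (y lab y' lab' : ℕ → ℕ) (t s : ℕ) : Prop :=
  ∀ j < n - 1, (y j + if lab j < t then 1 else 0) = y' j + if lab' j < s then 1 else 0

theorem FlipMatch.symm {n : ℕ} {y lab y' lab' : ℕ → ℕ} {t s : ℕ}
    (h : FlipMatch n y lab y' lab' t s) : FlipMatch n y' lab' y lab s t :=
  fun j hj => (h j hj).symm

theorem flipVertex_eq_iff {n : ℕ} {y lab y' lab' : ℕ → ℕ} {t s : ℕ}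
    (hend : y (n - 2) = y' (n - 2)) :
    flipVertex n y lab t = flipVertex n y' lab' s ↔ FlipMatch n y lab y' lab' t s := by
  constructor
  · intro h j hj
    have := congrArg (prefixSum (j + 1)) h
    rw [prefixSum_flipVertex _ _ _ (by omega), prefixSum_flipVertex _ _ _ (by omega),
      flipHt_succ _ _ _ hj, flipHt_succ _ _ _ hj] at this
    exact_mod_cast this
  · intro h
    have key : ∀ j, flipHt n y lab t j = flipHt n y' lab' s j := by
      intro j
      by_cases hj : j ≤ n - 1
      · cases j with
        | zero => simp [flipHt]
        | succ j => rw [flipHt_succ _ _ _ hj, flipHt_succ _ _ _ hj, h j hj]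
      · simp [flipHt, hj, hend]
    funext i
    simp only [flipVertex, key]

theorem exists_sum_smul_eq_of_mem_convexHull_range {ι E : Type*} [Fintype ι] [AddCommGroup E] [Module ℝ E]
    (V : ι → E) {p : E} (hp : p ∈ convexHull ℝ (Set.range V)) :
    ∃ w : ι → ℝ, (∀ i, 0 ≤ w i) ∧ ∑ i, w i = 1 ∧ ∑ i, w i • V i = p := by
  classical
  rw [convexHull_range_eq_exists_affineCombination] at hp
  obtain ⟨s, w, hw0, hw1, rfl⟩ := hp
  refine ⟨fun i => if i ∈ s then w i else 0, ?_, ?_, ?_⟩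
  · intro i
    dsimp only
    split_ifs with h
    exacts [hw0 i h, le_rfl]
  · simpa [Finset.sum_ite_mem] using hw1
  · rw [Finset.affineCombination_eq_linear_combination _ _ _ hw1]
    simp [ite_smul, Finset.sum_ite_mem]

theorem snakeSimplex_eq_range (n : ℕ) (y lab : ℕ → ℕ) :
    snakeSimplex n y lab =
      convexHull ℝ (Set.range fun t : Fin n => flipVertex n y lab t) := by
  unfold snakeSimplex
  congr 1
  ext v
  simp only [Set.mem_ofPred_eq, Set.mem_range]
  constructor
  · rintro ⟨t, ht, rfl⟩
    exact ⟨⟨t, ht⟩, rfl⟩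
  · rintro ⟨t, rfl⟩
    exact ⟨t, t.2, rfl⟩

/-- The sum of the barycentric weights with index greater than `s`. -/
def tailSum {n : ℕ} (w : Fin n → ℝ) (s : ℕ) : ℝ :=
  ∑ t : Fin n, if s < t.val then w t else 0

theorem prefixSum_combination {n : ℕ} (y lab : ℕ → ℕ) (w : Fin n → ℝ) {j : ℕ}
    (hj : j < n - 1) :
    prefixSum (j + 1) (∑ t : Fin n, w t • flipVertex n y lab t) =
      (∑ t, w t) * y j + tailSum w (lab j) := by
  rw [prefixSum_sum_smul, tailSum, Finset.sum_mul, ← Finset.sum_add_distrib]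
  refine Finset.sum_congr rfl fun t _ => ?_
  rw [prefixSum_flipVertex _ _ _ (by omega), flipHt_succ _ _ _ hj]
  split_ifs <;> push_cast <;> ring

theorem tailSum_antitone {n : ℕ} {w : Fin n → ℝ} (hw : ∀ t, 0 ≤ w t) : Antitone (tailSum w) := by
  intro a b hab
  refine Finset.sum_le_sum fun t _ => ?_
  split_ifs with h1 h2
  exacts [le_rfl, absurd (hab.trans_lt h1) h2, hw t, le_rfl]

theorem tailSum_add_le {n : ℕ} {w : Fin n → ℝ} (hw : ∀ t, 0 ≤ w t) {a : ℕ} {t : Fin n}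
    (ha : a < t.val) : tailSum w t + w t ≤ tailSum w a := by
  have h : w t = ∑ i : Fin n, if i = t then w i else 0 := by simp
  conv_lhs => rw [h]
  rw [tailSum, tailSum, ← Finset.sum_add_distrib]
  refine Finset.sum_le_sum fun i _ => ?_
  have := hw i
  rcases eq_or_ne i t with rfl | hi
  · simp [ha]
  · simp only [hi, if_false, add_zero]
    split_ifs <;> first | omega | linarith

theorem tailSum_nonneg {n : ℕ} {w : Fin n → ℝ} (hw : ∀ t, 0 ≤ w t) (a : ℕ) :
    0 ≤ tailSum w a :=
  Finset.sum_nonneg fun t _ => by split_ifs; exacts [hw t, le_rfl]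

theorem tailSum_add_le_sum {n : ℕ} {w : Fin n → ℝ} (hw : ∀ t, 0 ≤ w t) (t : Fin n) :
    tailSum w t + w t ≤ ∑ i, w i := by
  have h : w t = ∑ i : Fin n, if i = t then w i else 0 := by simp
  conv_lhs => rw [h]
  rw [tailSum, ← Finset.sum_add_distrib]
  refine Finset.sum_le_sum fun i _ => ?_
  have := hw i
  rcases eq_or_ne i t with rfl | hi
  · simp
  · simp only [hi, if_false, add_zero]
    split_ifs <;> linarith

theorem tailSum_le_sum {n : ℕ} {w : Fin n → ℝ} (hw : ∀ t, 0 ≤ w t) (a : ℕ) :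
    tailSum w a ≤ ∑ i, w i :=
  Finset.sum_le_sum fun t _ => by split_ifs; exacts [le_rfl, hw t]

theorem tailSum_eq_zero {n : ℕ} (w : Fin n → ℝ) {a : ℕ} (ha : n - 1 ≤ a) : tailSum w a = 0 :=
  Finset.sum_eq_zero fun t _ => if_neg (by omega)

theorem ceil_natCast_add_sub (a : ℕ) {u θ : ℝ} (hu0 : 0 ≤ u) (hu1 : u ≤ 1) (hθ0 : 0 ≤ θ)
    (hθ1 : θ < 1) [Decidable (θ < u)] :
    ⌈(a : ℝ) + u - θ⌉ = ((a + if θ < u then 1 else 0 : ℕ) : ℤ) := by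
  rw [Int.ceil_eq_iff]
  split_ifs <;> push_cast <;> constructor <;> linarith

/-- A vertex of one simplex that carries positive weight at a point of another simplex is a
vertex of the latter. -/
theorem exists_flipMatch_of_pos {n : ℕ} {y lab y' lab' : ℕ → ℕ} {w w' : Fin n → ℝ}
    (hw : ∀ t, 0 ≤ w t) (hw1 : ∑ t, w t = 1) (hw' : ∀ t, 0 ≤ w' t) (hw1' : ∑ t, w' t = 1)
    (heq : ∑ t : Fin n, w t • flipVertex n y lab t = ∑ t : Fin n, w' t • flipVertex n y' lab' t)
    {t : Fin n} (ht : 0 < w t) :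
    ∃ s < n, FlipMatch n y lab y' lab' t s := by
  classical
  set θ := tailSum w t with hθ
  have hθ0 : 0 ≤ θ := tailSum_nonneg hw _
  have hθ1 : θ < 1 := by
    have := tailSum_add_le_sum hw t
    linarith
  have hex : ∃ s, tailSum w' s ≤ θ := ⟨n - 1, by rwa [tailSum_eq_zero w' le_rfl]⟩
  have hmem : ∀ a, a < Nat.find hex ↔ θ < tailSum w' a := by
    intro a
    rw [Nat.lt_find_iff]
    exact ⟨fun h => not_le.1 (h a le_rfl),
      fun h m hm hle => absurd ((tailSum_antitone hw' hm).trans hle) (not_le.2 h)⟩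
  refine ⟨Nat.find hex, ?_, fun j hj => ?_⟩
  · have := Nat.find_min' hex (m := n - 1) (by rwa [tailSum_eq_zero w' le_rfl])
    have := t.2
    omega
  · have hH := congrArg (prefixSum (j + 1)) heq
    rw [prefixSum_combination _ _ _ hj, prefixSum_combination _ _ _ hj, hw1, hw1', one_mul,
      one_mul] at hH
    have hlab : lab j < t.val ↔ θ < tailSum w (lab j) := by
      constructor
      · intro h
        have := tailSum_add_le hw h
        linarith
      · intro h
        by_contra hle
        exact absurd (tailSum_antitone hw (not_lt.1 hle)) (not_le.2 h)
    have h1 := ceil_natCast_add_sub (y j) (tailSum_nonneg hw (lab j))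
      (hw1 ▸ tailSum_le_sum hw (lab j)) hθ0 hθ1
    have h2 := ceil_natCast_add_sub (y' j) (tailSum_nonneg hw' (lab' j))
      (hw1' ▸ tailSum_le_sum hw' (lab' j)) hθ0 hθ1
    rw [hH, h2] at h1
    simp only [hlab, hmem]
    exact_mod_cast h1.symm

theorem affineIndependent_flipVertex {n : ℕ} {y lab : ℕ → ℕ}
    (hb : Set.BijOn lab (Set.Iio (n - 1)) (Set.Iio (n - 1))) :
    AffineIndependent ℝ fun t : Fin n => flipVertex n y lab t := by
  rw [affineIndependent_iff_of_fintype]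
  intro w hw0 hw
  rw [Finset.univ.weightedVSub_eq_linear_combination hw0] at hw
  have htail : ∀ s, tailSum w s = 0 := by
    intro s
    rcases lt_or_ge s (n - 1) with hs | hs
    · obtain ⟨j, hj, rfl⟩ := hb.surjOn hs
      have := prefixSum_combination y lab w hj
      rw [hw, hw0] at this
      simpa [prefixSum] using this.symm
    · exact tailSum_eq_zero w hs
  intro t
  have hstep : w t = (∑ i : Fin n, if t.val ≤ i.val then w i else 0) - tailSum w t := by
    rw [tailSum, ← Finset.sum_sub_distrib]
    have h : w t = ∑ i : Fin n, if i = t then w i else 0 := by simp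
    conv_lhs => rw [h]
    refine Finset.sum_congr rfl fun i _ => ?_
    rcases lt_trichotomy i.val t.val with h | h | h
    · simp [h.not_ge, h.not_gt, Fin.ext_iff, h.ne]
    · simp [Fin.ext_iff, h]
    · simp [h.le, h, Fin.ext_iff, h.ne']
  rw [hstep, htail, sub_zero]
  rcases Nat.eq_zero_or_pos t.val with h | h
  · simpa [h] using hw0
  · refine Eq.trans (Finset.sum_congr rfl fun i _ => ?_) (htail (t.val - 1))
    congr 1
    exact propext (by omega)

open Classical in
/-- The indices of the vertices of `(y, lab)` which are also vertices of `(y', lab')`. -/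
noncomputable def commonIndices (n : ℕ) (y lab y' lab' : ℕ → ℕ) : Finset (Fin n) :=
  Finset.univ.filter fun t => ∃ s < n, FlipMatch n y lab y' lab' t s

theorem mem_commonIndices {n : ℕ} {y lab y' lab' : ℕ → ℕ} {t : Fin n} :
    t ∈ commonIndices n y lab y' lab' ↔ ∃ s < n, FlipMatch n y lab y' lab' t s := by
  simp [commonIndices]

theorem snakeSimplex_inter {n : ℕ} {y lab y' lab' : ℕ → ℕ} (hend : y (n - 2) = y' (n - 2)) :
    snakeSimplex n y lab ∩ snakeSimplex n y' lab' =
      convexHull ℝ ((fun t : Fin n => flipVertex n y lab t) ''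
        commonIndices n y lab y' lab') := by
  rw [snakeSimplex_eq_range, snakeSimplex_eq_range]
  apply Set.Subset.antisymm
  · rintro p ⟨hp, hp'⟩
    obtain ⟨w, hw, hw1, rfl⟩ := exists_sum_smul_eq_of_mem_convexHull_range _ hp
    obtain ⟨w', hw', hw1', heq⟩ := exists_sum_smul_eq_of_mem_convexHull_range _ hp'
    have hmem : ∀ t, w t ≠ 0 → t ∈ commonIndices n y lab y' lab' := fun t ht =>
      mem_commonIndices.2
        (exists_flipMatch_of_pos hw hw1 hw' hw1' heq.symm (lt_of_le_of_ne (hw t) ht.symm))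
    rw [← Finset.sum_subset (Finset.subset_univ (commonIndices n y lab y' lab'))
      fun t _ ht => by rw [not_imp_comm.1 (hmem t) ht, zero_smul]]
    rw [← Finset.sum_subset (Finset.subset_univ (commonIndices n y lab y' lab'))
      fun t _ ht => not_imp_comm.1 (hmem t) ht] at hw1
    exact (convex_convexHull ℝ _).sum_mem (fun t _ => hw t) hw1
      fun t ht => subset_convexHull ℝ _ ⟨t, ht, rfl⟩
  · refine Set.subset_inter (convexHull_mono (Set.image_subset_range _ _)) (convexHull_mono ?_)
    rintro _ ⟨t, ht, rfl⟩
    obtain ⟨s, hs, hst⟩ := mem_commonIndices.1 ht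
    exact ⟨⟨s, hs⟩, ((flipVertex_eq_iff hend).2 hst).symm⟩

theorem finrank_vectorSpan_inter {n : ℕ} {y lab y' lab' : ℕ → ℕ}
    (hb : Set.BijOn lab (Set.Iio (n - 1)) (Set.Iio (n - 1))) (hend : y (n - 2) = y' (n - 2)) :
    Module.finrank ℝ ↥(vectorSpan ℝ (snakeSimplex n y lab ∩ snakeSimplex n y' lab')) =
      (commonIndices n y lab y' lab').card - 1 := by
  classical
  rw [snakeSimplex_inter hend, ← direction_affineSpan, affineSpan_convexHull,
    direction_affineSpan]
  rcases (commonIndices n y lab y' lab').eq_empty_or_nonempty with h | h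
  · rw [h, Finset.coe_empty, Set.image_empty, vectorSpan_empty, finrank_bot]
    rfl
  · rw [← Finset.coe_image]
    exact (affineIndependent_flipVertex hb).finrank_vectorSpan_image_finset
      (Nat.succ_pred_eq_of_pos h.card_pos).symm

theorem finrank_vectorSpan_snakeSimplex {n : ℕ} {y lab : ℕ → ℕ}
    (hb : Set.BijOn lab (Set.Iio (n - 1)) (Set.Iio (n - 1))) :
    Module.finrank ℝ ↥(vectorSpan ℝ (snakeSimplex n y lab)) = n - 1 := by
  have hI : commonIndices n y lab y lab = Finset.univ :=
    Finset.eq_univ_of_forall fun t => mem_commonIndices.2 ⟨t, t.2, fun _ _ => rfl⟩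
  have h := finrank_vectorSpan_inter (y' := y) (lab' := lab) hb rfl
  rwa [Set.inter_self, hI, Finset.card_univ, Fintype.card_fin] at h

theorem sum_ite_lt_of_bijOn {m : ℕ} {lab : ℕ → ℕ} (hb : Set.BijOn lab (Set.Iio m) (Set.Iio m))
    {t : ℕ} (ht : t ≤ m) :
    ∑ j ∈ Finset.range m, (if lab j < t then 1 else 0) = t := by
  have h : ∑ j ∈ Finset.range m, (if lab j < t then 1 else 0) =
      ∑ j ∈ Finset.range m, if j < t then 1 else 0 :=
    Finset.sum_nbij lab (fun j hj => by simpa using hb.mapsTo (by simpa using hj))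
      (by simpa using hb.injOn) (by simpa using hb.surjOn) fun _ _ => rfl
  rw [h, ← Finset.card_filter]
  have hf : (Finset.range m).filter (fun j => j < t) = Finset.range t := by
    ext j; simp only [Finset.mem_filter, Finset.mem_range]; omega
  rw [hf, Finset.card_range]

theorem FlipMatch.sum_add_eq {n : ℕ} {y lab y' lab' : ℕ → ℕ}
    (hb : Set.BijOn lab (Set.Iio (n - 1)) (Set.Iio (n - 1)))
    (hb' : Set.BijOn lab' (Set.Iio (n - 1)) (Set.Iio (n - 1))) {t s : ℕ} (ht : t < n)
    (hs : s < n) (h : FlipMatch n y lab y' lab' t s) :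
    ∑ j ∈ Finset.range (n - 1), y j + t = ∑ j ∈ Finset.range (n - 1), y' j + s := by
  have := Finset.sum_congr rfl fun j hj => h j (Finset.mem_range.1 hj)
  rwa [Finset.sum_add_distrib, Finset.sum_add_distrib, sum_ite_lt_of_bijOn hb (by omega),
    sum_ite_lt_of_bijOn hb' (by omega)] at this

theorem eq_of_forall_flipMatch {n : ℕ} {y lab y' lab' : ℕ → ℕ}
    (hb : Set.BijOn lab (Set.Iio (n - 1)) (Set.Iio (n - 1)))
    (hb' : Set.BijOn lab' (Set.Iio (n - 1)) (Set.Iio (n - 1)))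
    (h : ∀ t < n, FlipMatch n y lab y' lab' t t) :
    ∀ j < n - 1, y j = y' j ∧ lab j = lab' j := by
  intro j hj
  have hl : lab j < n - 1 := hb.mapsTo hj
  have hl' : lab' j < n - 1 := hb'.mapsTo hj
  have h0 := h 0 (by omega) j hj
  have h1 := h (lab j + 1) (by omega) j hj
  have h2 := h (lab' j + 1) (by omega) j hj
  simp only [not_lt_zero, if_false, add_zero] at h0
  refine ⟨h0, ?_⟩
  split_ifs at h1 h2 <;> omega

theorem eq_of_commonIndices_eq_univ {n : ℕ} {y lab y' lab' : ℕ → ℕ}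
    (hb : Set.BijOn lab (Set.Iio (n - 1)) (Set.Iio (n - 1)))
    (hb' : Set.BijOn lab' (Set.Iio (n - 1)) (Set.Iio (n - 1)))
    (h : commonIndices n y lab y' lab' = Finset.univ) :
    ∀ j < n - 1, y j = y' j ∧ lab j = lab' j := by
  refine eq_of_forall_flipMatch hb hb' fun t ht => ?_
  have hmem : ∀ t < n, ∃ s < n, FlipMatch n y lab y' lab' t s := fun t ht =>
    mem_commonIndices.1 (h ▸ Finset.mem_univ (⟨t, ht⟩ : Fin n))
  obtain ⟨s, hs, hst⟩ := hmem t ht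
  obtain ⟨a, ha, h0a⟩ := hmem 0 (by omega)
  obtain ⟨b, hb1, hmb⟩ := hmem (n - 1) (by omega)
  have e1 := hst.sum_add_eq hb hb' ht hs
  have e2 := h0a.sum_add_eq hb hb' (by omega) ha
  have e3 := hmb.sum_add_eq hb hb' (by omega) hb1
  obtain rfl : s = t := by omega
  exact hst

theorem sharesFacet_iff {n : ℕ} (hn : 2 ≤ n) {y lab y' lab' : ℕ → ℕ}
    (hb : Set.BijOn lab (Set.Iio (n - 1)) (Set.Iio (n - 1)))
    (hb' : Set.BijOn lab' (Set.Iio (n - 1)) (Set.Iio (n - 1)))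
    (h0 : y 0 = y' 0) (hend : y (n - 2) = y' (n - 2)) :
    SharesFacet (snakeSimplex n y lab) (snakeSimplex n y' lab') ↔
      (commonIndices n y lab y' lab').card + 1 = n := by
  have hcongr : (∀ j < n - 1, y j = y' j ∧ lab j = lab' j) →
      snakeSimplex n y lab = snakeSimplex n y' lab' := by
    intro h
    rw [snakeSimplex_eq_range, snakeSimplex_eq_range]
    congr 2
    funext t
    exact (flipVertex_eq_iff hend).2 fun j hj => by rw [(h j hj).1, (h j hj).2]
  rw [SharesFacet, finrank_vectorSpan_inter hb hend, finrank_vectorSpan_snakeSimplex hb]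
  constructor
  · rintro ⟨hne, hc⟩
    rcases hn.eq_or_lt with rfl | hn
    · refine absurd (hcongr fun j hj => ?_) hne
      obtain rfl : j = 0 := by omega
      have h1 : lab 0 < 1 := hb.mapsTo (show (0 : ℕ) < 1 by omega)
      have h2 : lab' 0 < 1 := hb'.mapsTo (show (0 : ℕ) < 1 by omega)
      exact ⟨h0, by omega⟩
    · omega
  · refine fun hc => ⟨fun heq => ?_, by omega⟩
    have h1 := finrank_vectorSpan_inter (lab' := lab') hb hend
    rw [← heq, Set.inter_self, finrank_vectorSpan_snakeSimplex hb] at h1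
    omega

theorem card_commonIndices_add_one {n : ℕ} {y lab y' lab' : ℕ → ℕ} (t₀ : Fin n)
    (hb : Set.BijOn lab (Set.Iio (n - 1)) (Set.Iio (n - 1)))
    (hb' : Set.BijOn lab' (Set.Iio (n - 1)) (Set.Iio (n - 1)))
    (hne : ∃ j < n - 1, ¬ (y j = y' j ∧ lab j = lab' j))
    (h : ∀ t < n, t ≠ t₀ → ∃ s < n, FlipMatch n y lab y' lab' t s) :
    (commonIndices n y lab y' lab').card + 1 = n := by
  have ht₀ : t₀ ∉ commonIndices n y lab y' lab' := by
    intro hmem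
    obtain ⟨j, hj, hjne⟩ := hne
    refine hjne (eq_of_commonIndices_eq_univ hb hb' (Finset.eq_univ_of_forall fun t => ?_) j hj)
    by_cases ht : t = t₀
    · rwa [ht]
    · exact mem_commonIndices.2 (h t t.2 fun h => ht (Fin.ext h))
  have hI : commonIndices n y lab y' lab' = Finset.univ.erase t₀ := by
    ext t
    rw [Finset.mem_erase, and_iff_left (Finset.mem_univ t)]
    exact ⟨fun ht h => ht₀ (h ▸ ht),
      fun ht => mem_commonIndices.2 (h t t.2 fun h => ht (Fin.ext h))⟩
  rw [hI, Finset.card_erase_add_one (Finset.mem_univ t₀), Finset.card_univ, Fintype.card_fin]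

theorem exists_missing_index {n : ℕ} {y lab y' lab' : ℕ → ℕ}
    (h : (commonIndices n y lab y' lab').card + 1 = n) :
    ∃ t₀ < n, ∀ t < n, t ≠ t₀ → ∃ s < n, FlipMatch n y lab y' lab' t s := by
  have hc : (commonIndices n y lab y' lab')ᶜ.card = 1 := by
    rw [Finset.card_compl, Fintype.card_fin]
    omega
  obtain ⟨t₀, ht₀⟩ := Finset.card_eq_one.1 hc
  refine ⟨t₀, t₀.2, fun t ht hne => mem_commonIndices.1 (?_ : (⟨t, ht⟩ : Fin n) ∈ _)⟩
  by_contra hmem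
  rw [← Finset.mem_compl, ht₀, Finset.mem_singleton] at hmem
  exact hne (congrArg Fin.val hmem)

theorem moveBoxOne_of_flipMatch {n : ℕ} (hn : 2 ≤ n) {y lab y' lab' : ℕ → ℕ}
    (hb : Set.BijOn lab (Set.Iio (n - 1)) (Set.Iio (n - 1)))
    (hb' : Set.BijOn lab' (Set.Iio (n - 1)) (Set.Iio (n - 1)))
    (h : ∀ t < n - 1, FlipMatch n y lab y' lab' (t + 1) t) : MoveBoxOne n y lab y' lab' := by
  obtain ⟨j₀, hj₀, hlab⟩ := hb.surjOn (show (0 : ℕ) < n - 1 by omega)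
  have hz : ∀ j < n - 1, j ≠ j₀ → 0 < lab j := fun j hj hne => Nat.pos_of_ne_zero fun h0 =>
    hne (hb.injOn hj hj₀ (h0.trans hlab.symm))
  refine ⟨j₀, hj₀, hlab, fun j hj => ?_, fun j hj => ?_⟩
  · have h0 := h 0 (by omega) j (by omega)
    split_ifs with hjj
    · subst hjj
      simpa [hlab] using h0.symm
    · have := hz j (by omega) hjj
      simp only [not_lt_zero, if_false, add_zero] at h0
      split_ifs at h0 <;> omega
  · have hl : lab j < n - 1 := hb.mapsTo hj
    have hl' : lab' j < n - 1 := hb'.mapsTo hj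
    have h0 := h 0 (by omega) j hj
    simp only [not_lt_zero, if_false, add_zero] at h0
    split_ifs with hjj
    · subst hjj
      have h1 := h (n - 2) (by omega) j hj
      split_ifs at h0 h1 <;> omega
    · have := hz j hj hjj
      have h1 := h (lab j) hl j hj
      have h2 := h (lab j - 1) (by omega) j hj
      split_ifs at h0 h1 h2 <;> omega

theorem flipMatch_of_moveBoxOne {n : ℕ} {y lab y' lab' : ℕ → ℕ}
    (hb : Set.BijOn lab (Set.Iio (n - 1)) (Set.Iio (n - 1)))
    (h : MoveBoxOne n y lab y' lab') {t : ℕ} (ht : t < n - 1) :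
    FlipMatch n y lab y' lab' (t + 1) t := by
  obtain ⟨j₀, hj₀, hlab, hy, hl⟩ := h
  intro j hj
  rw [hy j (by omega), hl j hj]
  by_cases hjj : j = j₀
  · subst hjj
    simp only [if_true]
    split_ifs <;> omega
  · have : 0 < lab j := Nat.pos_of_ne_zero fun h0 => hjj (hb.injOn hj hj₀ (h0.trans hlab.symm))
    simp only [hjj, if_false]
    split_ifs <;> omega

theorem MoveBoxOne.exists_ne {n : ℕ} {y lab y' lab' : ℕ → ℕ} (h : MoveBoxOne n y lab y' lab') :
    ∃ j < n - 1, y j ≠ y' j := by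
  obtain ⟨j₀, hj₀, -, hy, -⟩ := h
  refine ⟨j₀, hj₀, ?_⟩
  rw [hy j₀ (by omega), if_pos rfl]
  omega

theorem differBySwap_of_flipMatch {n : ℕ} {y lab y' lab' : ℕ → ℕ}
    (hb : Set.BijOn lab (Set.Iio (n - 1)) (Set.Iio (n - 1)))
    (hb' : Set.BijOn lab' (Set.Iio (n - 1)) (Set.Iio (n - 1)))
    (hy : ∀ j < n - 1, y j = y' j) (hne : ∃ j < n - 1, lab' j ≠ lab j) {t₀ : ℕ}
    (h : ∀ t < n, t ≠ t₀ → FlipMatch n y lab y' lab' t t) : DifferBySwap n lab lab' := by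
  have hcase : ∀ j < n - 1, lab' j = lab j ∨ lab j + 1 = t₀ ∧ lab' j = t₀ ∨
      lab j = t₀ ∧ lab' j + 1 = t₀ := by
    intro j hj
    have hl : lab j < n - 1 := hb.mapsTo hj
    have hl' : lab' j < n - 1 := hb'.mapsTo hj
    have hyj := hy j hj
    have h1 := fun hne => h (lab j + 1) (by omega) hne j hj
    have h2 := fun hne => h (lab' j + 1) (by omega) hne j hj
    have h3 := fun hne => h (lab j) (by omega) hne j hj
    have h4 := fun hne => h (lab' j) (by omega) hne j hj
    split_ifs at h1 h2 h3 h4 <;> omega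
  refine ⟨⟨t₀ - 1, fun j hj => ?_⟩, hne⟩
  obtain ⟨i, hi, hine⟩ := hne
  have hli : lab i < n - 1 := hb.mapsTo hi
  have hli' : lab' i < n - 1 := hb'.mapsTo hi
  have hci := hcase i hi
  have hcj := hcase j hj
  have hinj : lab i = lab j → i = j := fun e => hb.injOn hi hj e
  have hinj' : lab' i = lab' j → i = j := fun e => hb'.injOn hi hj e
  by_cases hij : i = j
  · subst hij
    split_ifs <;> omega
  · obtain ⟨k, hk, hlk⟩ := hb.surjOn hli'
    have hck := hcase k hk
    have hik' : lab' i = lab' k → i = k := fun e => hb'.injOn hi hk e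
    have hkj : lab k = lab j → k = j := fun e => hb.injOn hk hj e
    have hkj' : lab' k = lab' j → k = j := fun e => hb'.injOn hk hj e
    have hki : i = k → lab k = lab i := fun e => e ▸ rfl
    have hkj2 : k = j → lab' k = lab' j := fun e => e ▸ rfl
    split_ifs <;> omega

theorem flipMatch_of_swap {n : ℕ} {y lab y' lab' : ℕ → ℕ} (hy : ∀ j < n - 1, y j = y' j) {t₀ : ℕ}
    (h : ∀ j < n - 1, lab' j = if lab j = t₀ then t₀ + 1 else if lab j = t₀ + 1 then t₀ else lab j)
    {t : ℕ} (ht : t ≠ t₀ + 1) : FlipMatch n y lab y' lab' t t := by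
  intro j hj
  rw [hy j hj, h j hj]
  split_ifs <;> omega

/-- Let `M = M[U,L]` be a lattice path matroid.  Two maximal
simplices of the alcoved triangulation of `P_M`, indexed by `(S, ℒ) = (y, lab)` and
`(S', ℒ') = (y', lab')`, form an edge of the dual graph (share a facet) if and only if
either (i) they lie in the same snake and the labellings differ by one swap of adjacent
labels, or (ii) one of them is obtained from the other by moving the box labelled `1`
one unit up and one unit left, with the labels shifted cyclically. -/
theorem lpm_dual_graph_edges {n : ℕ} (hn : 2 ≤ n) (U L : Finset (Fin n))
    (hcard : U.card = L.card) (habove : ∀ i, pathHeight L i ≤ pathHeight U i)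
    (y lab y' lab' : ℕ → ℕ)
    (hS : SnakeInside U L y) (hL : IsSnakeLabelling n y lab)
    (hS' : SnakeInside U L y') (hL' : IsSnakeLabelling n y' lab') :
    SharesFacet (snakeSimplex n y lab) (snakeSimplex n y' lab') ↔
      (((∀ j : ℕ, j ≤ n - 2 → y j = y' j) ∧ DifferBySwap n lab lab') ∨
       MoveBoxOne n y lab y' lab' ∨ MoveBoxOne n y' lab' y lab) := by
  have hb := hL.1
  have hb' := hL'.1
  have hend : y (n - 2) = y' (n - 2) := by
    have := hS.2.2.2
    have := hS'.2.2.2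
    omega
  rw [sharesFacet_iff hn hb hb' (hS.1.trans hS'.1.symm) hend]
  constructor
  · intro hc
    obtain ⟨t₀, ht₀, h⟩ := exists_missing_index hc
    obtain ⟨d, hd⟩ : ∃ d : ℤ, ∀ t < n, t ≠ t₀ →
        ∃ s < n, (s : ℤ) = t + d ∧ FlipMatch n y lab y' lab' t s := by
      refine ⟨∑ j ∈ Finset.range (n - 1), y j - ∑ j ∈ Finset.range (n - 1), y' j,
        fun t ht hne => ?_⟩
      obtain ⟨s, hs, hst⟩ := h t ht hne
      have := hst.sum_add_eq hb hb' ht hs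
      exact ⟨s, hs, by omega, hst⟩
    have hdt : ∀ t < n, t ≠ t₀ → 0 ≤ t + d ∧ t + d < n := fun t ht hne => by
      obtain ⟨s, hs, hsd, -⟩ := hd t ht hne
      omega
    have hd3 : d = 0 ∨ d = 1 ∧ t₀ = n - 1 ∨ d = -1 ∧ t₀ = 0 := by
      have h0 := hdt 0 (by omega)
      have h1 := hdt 1 (by omega)
      have h2 := hdt (n - 1) (by omega)
      have h3 := hdt (n - 2) (by omega)
      omega
    rcases hd3 with rfl | ⟨rfl, rfl⟩ | ⟨rfl, rfl⟩
    · have hmatch : ∀ t < n, t ≠ t₀ → FlipMatch n y lab y' lab' t t := fun t ht hne => by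
        obtain ⟨s, hs, hsd, hst⟩ := hd t ht hne
        obtain rfl : s = t := by omega
        exact hst
      have hy : ∀ j < n - 1, y j = y' j := by
        intro j hj
        have hl : lab j < n - 1 := hb.mapsTo hj
        have hl' : lab' j < n - 1 := hb'.mapsTo hj
        have h0 := fun hne => hmatch 0 (by omega) hne j hj
        have h1 := fun hne => hmatch (n - 1) (by omega) hne j hj
        simp only [not_lt_zero, if_false, hl, hl', if_true] at h0 h1
        omega
      refine Or.inl ⟨fun j hj => hy j (by omega),
        differBySwap_of_flipMatch hb hb' hy ?_ hmatch⟩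
      by_contra! hlab
      have huniv : commonIndices n y lab y' lab' = Finset.univ :=
        Finset.eq_univ_of_forall fun t => mem_commonIndices.2
          ⟨t, t.2, fun j hj => by rw [hy j hj, hlab j hj]⟩
      rw [huniv, Finset.card_univ, Fintype.card_fin] at hc
      omega
    · refine Or.inr (Or.inr (moveBoxOne_of_flipMatch hn hb' hb fun t ht => ?_))
      obtain ⟨s, hs, hsd, hst⟩ := hd t (by omega) (by omega)
      obtain rfl : s = t + 1 := by omega
      exact hst.symm
    · refine Or.inr (Or.inl (moveBoxOne_of_flipMatch hn hb hb' fun t ht => ?_))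
      obtain ⟨s, hs, hsd, hst⟩ := hd (t + 1) (by omega) (by omega)
      obtain rfl : s = t := by omega
      exact hst
  · rintro (⟨hy, ⟨t₀, hswap⟩, j, hj, hne⟩ | hmove | hmove)
    · by_cases ht₀ : t₀ + 1 < n
      · exact card_commonIndices_add_one ⟨t₀ + 1, ht₀⟩ hb hb' ⟨j, hj, fun h => hne h.2.symm⟩
          fun t ht hne => ⟨t, ht, flipMatch_of_swap (fun j hj => hy j (by omega)) hswap hne⟩
      · have hl : lab j < n - 1 := hb.mapsTo hj
        have := hswap j hj
        split_ifs at this <;> omega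
    · obtain ⟨j, hj, hne⟩ := hmove.exists_ne
      refine card_commonIndices_add_one ⟨0, by omega⟩ hb hb' ⟨j, hj, fun h => hne h.1⟩
        fun t ht hne => ⟨t - 1, by omega, ?_⟩
      have ht0 : t ≠ 0 := hne
      obtain ⟨t, rfl⟩ := Nat.exists_eq_succ_of_ne_zero ht0
      exact flipMatch_of_moveBoxOne hb hmove (by omega)
    · obtain ⟨j, hj, hne⟩ := hmove.exists_ne
      refine card_commonIndices_add_one ⟨n - 1, by omega⟩ hb hb' ⟨j, hj, fun h => hne h.1.symm⟩
        fun t ht hne => ?_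
      have ht1 : t ≠ n - 1 := hne
      exact ⟨t + 1, by omega, (flipMatch_of_moveBoxOne hb' hmove (by omega)).symm⟩
end

section
/- Let P be the matroid polytope of the uniform matroid U_{2,n}. Then the h*-vector of P satisfies: h*₀ + h*₁ = #{π ∈ P_{1,n−1} : ig(π) = 0}, and for every k ≥ 2, h*_k = #{π ∈ P_{1,n−1} : ig(π) = k−1}, where P_{1,n−1} is the set of permutations of [n−1] with exactly one descent and ig denotes the number of initial gaps. -/
/-!
Statement 16: A combinatorial interpretation of the `h*`-vector of the hypersimplex
`Δ_{2,n}` (the matroid polytope of `U_{2,n}`): `h*₀ + h*₁` counts permutations of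
`[n-1]` with one descent and no initial gaps, and `h*_k` (for `k ≥ 2`) counts those
with exactly `k - 1` initial gaps.
-/

open scoped Classical Pointwise

/-- The 0/1 indicator vector of a subset of `[n]`. -/
def indVec {n : ℕ} (B : Finset (Fin n)) : Fin n → ℝ :=
  fun i => if i ∈ B then 1 else 0

/-- The matroid polytope of the uniform matroid `U_{2,n}` (the hypersimplex
`Δ_{2,n}`). -/
def hypersimplexTwo (n : ℕ) : Set (Fin n → ℝ) :=
  convexHull ℝ {x | ∃ B : Finset (Fin n), B.card = 2 ∧ x = indVec B}

/-- The number of lattice (integer) points of a subset of `ℝⁿ`. -/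
noncomputable def latticeCount {n : ℕ} (S : Set (Fin n → ℝ)) : ℕ :=
  Set.ncard {x ∈ S | ∀ i, ∃ m : ℤ, x i = (m : ℝ)}

/-- `h` is the `h*`-vector of the lattice polytope `P` of dimension `d`:
`L_P(t) = ∑_{k=0}^{d} h_k · C(t + d - k, d)` for all `t ≥ 0`, and `h` vanishes beyond
degree `d`.  This encodes `∑_{t≥0} L_P(t) z^t = (∑_k h_k z^k)/(1-z)^{d+1}`. -/
def IsHStarVector {n : ℕ} (P : Set (Fin n → ℝ)) (d : ℕ) (h : ℕ → ℕ) : Prop :=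
  (∀ t : ℕ, latticeCount ((t : ℝ) • P) =
      ∑ k ∈ Finset.range (d + 1), h k * Nat.choose (t + d - k) d) ∧
  ∀ k, d < k → h k = 0

/-- The one-line notation of a permutation of `[m]` (0-based positions and values),
extended by `0` outside the range. -/
def oneLine {m : ℕ} (π : Equiv.Perm (Fin m)) (i : ℕ) : ℕ :=
  if h : i < m then (π ⟨i, h⟩ : ℕ) else 0

/-- The permutation `π` of `[m]` has a descent at (0-based) position `i`. -/
def DescentAt {m : ℕ} (π : Equiv.Perm (Fin m)) (i : ℕ) : Prop :=
  i + 1 < m ∧ oneLine π (i + 1) < oneLine π i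

/-- The number of descents of a permutation of `[m]`. -/
def descentCount {m : ℕ} (π : Equiv.Perm (Fin m)) : ℕ :=
  ((Finset.range m).filter fun i => i + 1 < m ∧ oneLine π (i + 1) < oneLine π i).card

/-- The number of initial gaps of a permutation `π` of `[m]`: the number of positions
`i` strictly before a descent of `π` with `π_{i+1} ≠ π_i + 1`. -/
def initialGaps {m : ℕ} (π : Equiv.Perm (Fin m)) : ℕ :=
  ((Finset.range m).filter fun i =>
    (∃ d ∈ Finset.range m, (d + 1 < m ∧ oneLine π (d + 1) < oneLine π d) ∧ i < d) ∧
      oneLine π (i + 1) ≠ oneLine π i + 1).card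

section Grassmannian

variable {m : ℕ}

theorem oneLine_of_lt (π : Equiv.Perm (Fin m)) {i : ℕ} (hi : i < m) :
    oneLine π i = (π ⟨i, hi⟩ : ℕ) := by
  simp [oneLine, hi]

theorem oneLine_lt (π : Equiv.Perm (Fin m)) {i : ℕ} (hi : i < m) : oneLine π i < m := by
  rw [oneLine_of_lt π hi]
  exact (π ⟨i, hi⟩).2

theorem oneLine_inj (π : Equiv.Perm (Fin m)) {i j : ℕ} (hi : i < m) (hj : j < m)
    (hij : oneLine π i = oneLine π j) : i = j := by
  rw [oneLine_of_lt π hi, oneLine_of_lt π hj] at hij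
  simpa using π.injective (Fin.ext hij)

theorem exists_oneLine_eq (π : Equiv.Perm (Fin m)) {v : ℕ} (hv : v < m) :
    ∃ i < m, oneLine π i = v := by
  refine ⟨π.symm ⟨v, hv⟩, (π.symm ⟨v, hv⟩).2, ?_⟩
  rw [oneLine_of_lt π (π.symm ⟨v, hv⟩).2]
  simp

/-- `d` is the only descent of the permutation `π` of `[m]`. -/
def IsUniqueDescent (π : Equiv.Perm (Fin m)) (d : ℕ) : Prop :=
  DescentAt π d ∧ ∀ i, i + 1 < m → i ≠ d → oneLine π i < oneLine π (i + 1)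

theorem descentCount_eq_one_iff (π : Equiv.Perm (Fin m)) :
    descentCount π = 1 ↔ ∃ d, IsUniqueDescent π d := by
  unfold descentCount
  rw [Finset.card_eq_one]
  refine exists_congr fun d => ?_
  constructor
  · intro h
    have key : ∀ i, i ∈ ((Finset.range m).filter fun i =>
        i + 1 < m ∧ oneLine π (i + 1) < oneLine π i) ↔ i = d := by
      intro i; rw [h, Finset.mem_singleton]
    refine ⟨(Finset.mem_filter.1 ((key d).2 rfl)).2, fun i hi hid => ?_⟩
    by_contra hlt
    refine hid ((key i).1 (Finset.mem_filter.2 ⟨Finset.mem_range.2 (by omega), hi, ?_⟩))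
    refine lt_of_le_of_ne (not_lt.1 hlt) fun heq => ?_
    have := oneLine_inj π hi (by omega) heq
    omega
  · rintro ⟨⟨h1, h2⟩, h3⟩
    ext i
    simp only [Finset.mem_filter, Finset.mem_range, Finset.mem_singleton]
    constructor
    · rintro ⟨-, hi, hlt⟩
      by_contra hid
      exact absurd (h3 i hi hid) (by omega)
    · rintro rfl
      exact ⟨by omega, h1, h2⟩

/-- The set of values of `π` at positions up to its last descent. -/
noncomputable def initialValues (π : Equiv.Perm (Fin m)) : Finset ℕ :=
  ((Finset.range m).filter fun i => ∃ d, i ≤ d ∧ DescentAt π d).image (oneLine π)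

/-- The number of maximal runs of consecutive integers in a finite set. -/
def blockCount (S : Finset ℕ) : ℕ :=
  (S.filter fun v => v + 1 ∉ S).card

namespace IsUniqueDescent

variable {π : Equiv.Perm (Fin m)} {d : ℕ}

theorem eq_of_descentAt (h : IsUniqueDescent π d) {i : ℕ} (hi : DescentAt π i) : i = d := by
  by_contra hid
  exact absurd (h.2 i hi.1 hid) (by have := hi.2; omega)

theorem lt_left (h : IsUniqueDescent π d) {i j : ℕ} (hij : i < j) (hj : j ≤ d) :
    oneLine π i < oneLine π j := by
  have hd := h.1.1
  induction j, hij using Nat.le_induction with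
  | base => exact h.2 i (by omega) (by omega)
  | succ j hj' ih => exact (ih (by omega)).trans (h.2 j (by omega) (by omega))

theorem lt_right (h : IsUniqueDescent π d) {i j : ℕ} (hi : d < i) (hij : i < j) (hj : j < m) :
    oneLine π i < oneLine π j := by
  induction j, hij using Nat.le_induction with
  | base => exact h.2 i (by omega) (by omega)
  | succ j hj' ih => exact (ih (by omega)).trans (h.2 j (by omega) (by omega))

theorem initialValues_eq (h : IsUniqueDescent π d) :
    initialValues π = (Finset.range (d + 1)).image (oneLine π) := by
  unfold initialValues
  congr 1
  ext i
  simp only [Finset.mem_filter, Finset.mem_range]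
  constructor
  · rintro ⟨-, e, hie, he⟩
    rw [h.eq_of_descentAt he] at hie
    omega
  · intro hi
    exact ⟨by have := h.1.1; omega, d, by omega, h.1⟩

theorem oneLine_mem_initialValues (h : IsUniqueDescent π d) {i : ℕ} (hi : i < m) :
    oneLine π i ∈ initialValues π ↔ i ≤ d := by
  have hd := h.1.1
  rw [h.initialValues_eq, Finset.mem_image]
  constructor
  · rintro ⟨j, hj, hji⟩
    rw [Finset.mem_range] at hj
    rw [← oneLine_inj π (by omega) hi hji]
    omega
  · intro hid
    exact ⟨i, Finset.mem_range.2 (by omega), rfl⟩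

theorem injOn_range (h : IsUniqueDescent π d) :
    Set.InjOn (oneLine π) (Finset.range (d + 1) : Set ℕ) := by
  have hd := h.1.1
  intro i hi j hj hij
  simp only [Finset.coe_range, Set.mem_Iio] at hi hj
  exact oneLine_inj π (by omega) (by omega) hij

theorem card_initialValues (h : IsUniqueDescent π d) : (initialValues π).card = d + 1 := by
  rw [h.initialValues_eq, Finset.card_image_of_injOn h.injOn_range, Finset.card_range]

theorem count_mem (h : IsUniqueDescent π d) {i : ℕ} (hi : i ≤ d) :
    Nat.count (· ∈ initialValues π) (oneLine π i) = i := by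
  have hd := h.1.1
  rw [Nat.count_eq_card_filter_range]
  have : (Finset.range (oneLine π i)).filter (· ∈ initialValues π)
      = (Finset.range i).image (oneLine π) := by
    ext v
    simp only [Finset.mem_filter, Finset.mem_range, Finset.mem_image]
    constructor
    · rintro ⟨hv, hS⟩
      obtain ⟨j, hj, rfl⟩ := exists_oneLine_eq π (hv.trans (oneLine_lt π (by omega)))
      rw [h.oneLine_mem_initialValues hj] at hS
      refine ⟨j, ?_, rfl⟩
      by_contra hji
      rcases (not_lt.1 hji).eq_or_lt with rfl | hlt
      · omega
      · have := h.lt_left hlt hS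
        omega
    · rintro ⟨j, hj, rfl⟩
      exact ⟨h.lt_left hj hi, (h.oneLine_mem_initialValues (by omega)).2 (by omega)⟩
  rw [this, Finset.card_image_of_injOn (h.injOn_range.mono fun x hx => ?_), Finset.card_range]
  simp only [Finset.coe_range, Set.mem_Iio] at hx ⊢
  omega

theorem count_not_mem (h : IsUniqueDescent π d) {i : ℕ} (hi : d < i) (him : i < m) :
    Nat.count (· ∉ initialValues π) (oneLine π i) = i - (d + 1) := by
  rw [Nat.count_eq_card_filter_range]
  have : (Finset.range (oneLine π i)).filter (· ∉ initialValues π)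
      = (Finset.Ico (d + 1) i).image (oneLine π) := by
    ext v
    simp only [Finset.mem_filter, Finset.mem_range, Finset.mem_image, Finset.mem_Ico]
    constructor
    · rintro ⟨hv, hS⟩
      obtain ⟨j, hj, rfl⟩ := exists_oneLine_eq π (hv.trans (oneLine_lt π him))
      rw [h.oneLine_mem_initialValues hj] at hS
      refine ⟨j, ⟨by omega, ?_⟩, rfl⟩
      by_contra hji
      rcases (not_lt.1 hji).eq_or_lt with rfl | hlt
      · omega
      · have := h.lt_right hi hlt hj
        omega
    · rintro ⟨j, hj, rfl⟩
      refine ⟨h.lt_right (by omega) hj.2 him, ?_⟩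
      rw [h.oneLine_mem_initialValues (by omega)]
      omega
  rw [this, Finset.card_image_of_injOn, Nat.card_Ico]
  intro a ha b hb hab
  simp only [Finset.coe_Ico, Set.mem_Ico] at ha hb
  exact oneLine_inj π (by omega) (by omega) hab

theorem blockCount_initialValues (h : IsUniqueDescent π d) :
    blockCount (initialValues π) = initialGaps π + 1 := by
  have hd := h.1.1
  have hgaps : initialGaps π =
      ((Finset.range d).filter fun i => oneLine π i + 1 ∉ initialValues π).card := by
    unfold initialGaps
    congr 1
    ext i
    simp only [Finset.mem_filter, Finset.mem_range]
    have key : i < d → (oneLine π i + 1 ∈ initialValues π ↔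
        oneLine π (i + 1) = oneLine π i + 1) := by
      intro hi
      constructor
      · intro hmem
        rw [h.initialValues_eq, Finset.mem_image] at hmem
        obtain ⟨j, hj, hji⟩ := hmem
        rw [Finset.mem_range] at hj
        rcases lt_trichotomy (i + 1) j with hlt | rfl | hlt
        · have h1 := h.lt_left hlt (by omega)
          have h2 := h.lt_left (lt_add_one i) (by omega)
          omega
        · exact hji
        · rcases (Nat.lt_succ_iff.1 hlt).eq_or_lt with rfl | hlt'
          · omega
          · have := h.lt_left hlt' (by omega)
            omega
      · intro heq
        rw [← heq, h.oneLine_mem_initialValues (by omega)]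
        omega
    constructor
    · rintro ⟨-, ⟨e, -, he, hie⟩, hne⟩
      rw [h.eq_of_descentAt he] at hie
      exact ⟨hie, by rwa [key hie]⟩
    · rintro ⟨hi, hne⟩
      exact ⟨by omega, ⟨d, by omega, h.1, hi⟩, by rwa [key hi] at hne⟩
  have hlast : oneLine π d + 1 ∉ initialValues π := by
    rw [h.initialValues_eq, Finset.mem_image]
    rintro ⟨j, hj, hji⟩
    rw [Finset.mem_range] at hj
    rcases (Nat.lt_succ_iff.1 hj).eq_or_lt with rfl | hlt
    · omega
    · have := h.lt_left hlt le_rfl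
      omega
  have hinj := h.injOn_range
  rw [hgaps, blockCount]
  have : (initialValues π).filter (fun v => v + 1 ∉ initialValues π) =
      ((Finset.range (d + 1)).filter fun i => oneLine π i + 1 ∉ initialValues π).image
        (oneLine π) := by
    conv_lhs => enter [2]; rw [h.initialValues_eq]
    rw [Finset.filter_image]
  rw [this, Finset.card_image_of_injOn (hinj.mono (by
    intro x hx
    exact (Finset.mem_filter.1 hx).1)), Finset.range_add_one, Finset.filter_insert,
    if_pos hlast, Finset.card_insert_of_notMem (by simp)]

theorem initialValues_ne_range (h : IsUniqueDescent π d) (c : ℕ) :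
    initialValues π ≠ Finset.range c := by
  intro heq
  have hd := h.1.1
  have h1 := (h.oneLine_mem_initialValues (i := d) (by omega)).2 le_rfl
  have h2 := (h.oneLine_mem_initialValues (i := d + 1) (by omega)).not.2 (by omega)
  rw [heq, Finset.mem_range] at h1 h2
  have := h.1.2
  omega

end IsUniqueDescent

theorem initialValues_subset (π : Equiv.Perm (Fin m)) : initialValues π ⊆ Finset.range m := by
  intro v hv
  obtain ⟨i, hi, rfl⟩ := Finset.mem_image.1 hv
  exact Finset.mem_range.2 (oneLine_lt π (Finset.mem_range.1 (Finset.mem_filter.1 hi).1))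

/-- The position of the value `v` in the word that lists the elements of `S` increasingly and
then those of its complement increasingly. -/
noncomputable def shufflePosition (S : Finset ℕ) (v : ℕ) : ℕ :=
  if v ∈ S then Nat.count (· ∈ S) v else S.card + Nat.count (· ∉ S) v

theorem IsUniqueDescent.shufflePosition_oneLine {π : Equiv.Perm (Fin m)} {d : ℕ}
    (h : IsUniqueDescent π d) {i : ℕ} (hi : i < m) :
    shufflePosition (initialValues π) (oneLine π i) = i := by
  simp only [shufflePosition, h.oneLine_mem_initialValues hi, h.card_initialValues]
  split_ifs with hid
  · exact h.count_mem hid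
  · rw [h.count_not_mem (by omega) hi]
    omega

theorem initialValues_injOn :
    Set.InjOn initialValues {π : Equiv.Perm (Fin m) | descentCount π = 1} := by
  intro π hπ ρ hρ heq
  obtain ⟨d, hd⟩ := (descentCount_eq_one_iff π).1 hπ
  obtain ⟨e, he⟩ := (descentCount_eq_one_iff ρ).1 hρ
  ext i
  obtain ⟨j, hj, hji⟩ := exists_oneLine_eq ρ (oneLine_lt π i.2)
  have h1 := hd.shufflePosition_oneLine i.2
  have h2 := he.shufflePosition_oneLine hj
  rw [hji, ← heq, h1] at h2
  rw [← h2, oneLine_of_lt π i.2, oneLine_of_lt ρ i.2] at hji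
  exact hji.symm

section Shuffle

variable {S : Finset ℕ}

theorem count_mem_lt_card {v : ℕ} (hv : v ∈ S) : Nat.count (· ∈ S) v < S.card := by
  rw [Nat.count_eq_card_filter_range]
  refine Finset.card_lt_card ⟨fun x hx => (Finset.mem_filter.1 hx).2, fun hsub => ?_⟩
  have := (Finset.mem_filter.1 (hsub hv)).1
  simp at this

theorem shufflePosition_lt_card {v : ℕ} : shufflePosition S v < S.card ↔ v ∈ S := by
  unfold shufflePosition
  split_ifs with hv
  · simp [hv, count_mem_lt_card hv]
  · simp [hv]

theorem shufflePosition_lt (hS : S ⊆ Finset.range m) {v : ℕ} (hv : v < m) :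
    shufflePosition S v < m := by
  by_cases hvS : v ∈ S
  · refine (shufflePosition_lt_card.2 hvS).trans_le ?_
    simpa using Finset.card_le_card hS
  · rw [shufflePosition, if_neg hvS]
    have h1 := Nat.count_strict_mono (p := (· ∉ S)) hvS hv
    have h2 : Nat.count (· ∉ S) m = m - S.card := by
      rw [Nat.count_eq_card_filter_range, Finset.filter_notMem_eq_sdiff,
        Finset.card_sdiff_of_subset hS, Finset.card_range]
    have h3 : S.card ≤ m := by simpa using Finset.card_le_card hS
    omega

theorem shufflePosition_mono {v w : ℕ} (h : v ∈ S ↔ w ∈ S) (hvw : v ≤ w) :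
    shufflePosition S v ≤ shufflePosition S w := by
  simp only [shufflePosition, h]
  split_ifs
  · exact Nat.count_monotone _ hvw
  · exact Nat.add_le_add_left (Nat.count_monotone _ hvw) _

theorem shufflePosition_injective : Function.Injective (shufflePosition S) := by
  intro v w hvw
  have h : v ∈ S ↔ w ∈ S := by
    rw [← shufflePosition_lt_card, ← shufflePosition_lt_card, hvw]
  unfold shufflePosition at hvw
  by_cases hw : w ∈ S
  · rw [if_pos hw, if_pos (h.2 hw)] at hvw
    exact Nat.count_injective (p := (· ∈ S)) (h.2 hw) hw hvw
  · rw [if_neg hw, if_neg (h.not.2 hw)] at hvw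
    exact Nat.count_injective (p := (· ∉ S)) (h.not.2 hw) hw (by omega)

theorem exists_perm_shufflePosition (hS : S ⊆ Finset.range m) :
    ∃ π : Equiv.Perm (Fin m), ∀ i < m, shufflePosition S (oneLine π i) = i := by
  let g : Fin m → Fin m := fun v => ⟨shufflePosition S v, shufflePosition_lt hS v.2⟩
  have hg : Function.Injective g := fun v w hvw =>
    Fin.ext (shufflePosition_injective (congrArg Fin.val hvw))
  let e := Equiv.ofBijective g (Finite.injective_iff_bijective.1 hg)
  refine ⟨e.symm, fun i hi => ?_⟩
  rw [oneLine_of_lt _ hi]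
  exact congrArg Fin.val (e.apply_symm_apply ⟨i, hi⟩)

theorem exists_initialValues_eq (hS : S ⊆ Finset.range m) (hne : ∀ c, S ≠ Finset.range c) :
    ∃ π : Equiv.Perm (Fin m), descentCount π = 1 ∧ initialValues π = S := by
  obtain ⟨π, hπ⟩ := exists_perm_shufflePosition hS
  have hmem : ∀ i < m, (oneLine π i ∈ S ↔ i < S.card) := fun i hi => by
    rw [← shufflePosition_lt_card, hπ i hi]
  have hasc : ∀ i, i + 1 < m → i + 1 ≠ S.card → oneLine π i < oneLine π (i + 1) := by
    intro i hi hic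
    by_contra hlt
    have := shufflePosition_mono (S := S) (v := oneLine π (i + 1)) (w := oneLine π i)
      (by rw [hmem _ hi, hmem i (by omega)]; omega) (not_lt.1 hlt)
    rw [hπ _ hi, hπ i (by omega)] at this
    omega
  have hcard : S.card ≤ m := by simpa using Finset.card_le_card hS
  have hdesc : ∃ d, d + 1 = S.card ∧ DescentAt π d := by
    by_contra hno
    have hall : ∀ i, i + 1 < m → oneLine π i < oneLine π (i + 1) := by
      intro i hi
      by_cases hic : i + 1 = S.card
      · by_contra hlt
        refine hno ⟨i, hic, hi, lt_of_le_of_ne (not_lt.1 hlt) fun heq => ?_⟩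
        have := oneLine_inj π hi (by omega) heq
        omega
      · exact hasc i hi hic
    have hmono : ∀ i j, i < j → j < m → oneLine π i < oneLine π j := by
      intro i j hij
      induction j, hij using Nat.le_induction with
      | base => exact hall i
      | succ j hj' ih => exact fun hj => (ih (by omega)).trans (hall j hj)
    refine hne S.card (Finset.eq_of_subset_of_card_le (fun v hv => ?_) (by simp))
    have hvm := Finset.mem_range.1 (hS hv)
    obtain ⟨i, hi, rfl⟩ := exists_oneLine_eq π hvm
    have hic := (hmem i hi).1 hv
    rw [Finset.mem_range]
    by_contra hge
    have hsub : Finset.range (oneLine π i + 1) ⊆ S := by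
      intro w hw
      rw [Finset.mem_range] at hw
      obtain ⟨j, hj, rfl⟩ := exists_oneLine_eq π (show w < m by omega)
      rw [hmem j hj]
      by_contra hjc
      have := hmono i j (by omega) hj
      omega
    have := Finset.card_le_card hsub
    rw [Finset.card_range] at this
    omega
  obtain ⟨d, hdc, hd⟩ := hdesc
  have hu : IsUniqueDescent π d := ⟨hd, fun i hi hid => hasc i hi (by omega)⟩
  refine ⟨π, (descentCount_eq_one_iff π).2 ⟨d, hu⟩, ?_⟩
  refine Finset.eq_of_subset_of_card_le (fun v hv => ?_) (by rw [hu.card_initialValues, hdc])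
  obtain ⟨i, hi, rfl⟩ := exists_oneLine_eq π (Finset.mem_range.1 (initialValues_subset π hv))
  rw [hu.oneLine_mem_initialValues hi] at hv
  exact (hmem i hi).2 (by omega)

end Shuffle

theorem card_descentCount_initialGaps (m j : ℕ) :
    (Finset.univ.filter fun π : Equiv.Perm (Fin m) =>
        descentCount π = 1 ∧ initialGaps π = j).card =
      ((Finset.range m).powerset.filter fun S =>
        (∀ c, S ≠ Finset.range c) ∧ blockCount S = j + 1).card := by
  refine Finset.card_nbij initialValues ?_ ?_ ?_
  · intro π hπ
    simp only [Finset.coe_filter, Finset.mem_univ, true_and, Set.mem_ofPred_eq] at hπ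
    obtain ⟨d, hd⟩ := (descentCount_eq_one_iff π).1 hπ.1
    simp only [Finset.coe_filter, Finset.mem_powerset, Set.mem_ofPred_eq]
    exact ⟨initialValues_subset π, hd.initialValues_ne_range,
      by rw [hd.blockCount_initialValues, hπ.2]⟩
  · refine initialValues_injOn.mono fun π hπ => ?_
    exact (Finset.mem_filter.1 hπ).2.1
  · intro S hS
    simp only [Finset.coe_filter, Finset.mem_powerset, Set.mem_ofPred_eq] at hS
    obtain ⟨π, h1, rfl⟩ := exists_initialValues_eq hS.1 hS.2.1
    obtain ⟨d, hd⟩ := (descentCount_eq_one_iff π).1 h1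
    refine ⟨π, ?_, rfl⟩
    have := hS.2.2
    rw [hd.blockCount_initialValues] at this
    simp only [Finset.coe_filter, Finset.mem_univ, true_and, Set.mem_ofPred_eq]
    exact ⟨h1, by omega⟩

end Grassmannian

theorem blockCount_insert {m : ℕ} {T : Finset ℕ} (hT : T ⊆ Finset.range m) :
    blockCount (insert m T) + (if ∃ v ∈ T, v + 1 = m then 1 else 0) = blockCount T + 1 := by
  have hlt : ∀ v ∈ T, v < m := fun v hv => Finset.mem_range.1 (hT hv)
  have h1 : (insert m T).filter (fun v => v + 1 ∉ insert m T) =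
      insert m (T.filter fun v => v + 1 ∉ T ∧ v + 1 ≠ m) := by
    ext v
    simp only [Finset.mem_filter, Finset.mem_insert]
    constructor
    · rintro ⟨rfl | hv, h⟩
      · exact Or.inl rfl
      · exact Or.inr ⟨hv, by tauto⟩
    · rintro (rfl | ⟨hv, h⟩)
      · refine ⟨Or.inl rfl, ?_⟩
        rintro (h | h)
        · omega
        · have := hlt _ h
          omega
      · exact ⟨Or.inr hv, by tauto⟩
  have h0 : m ∉ T.filter fun v => v + 1 ∉ T ∧ v + 1 ≠ m := fun h =>
    (hlt m (Finset.mem_filter.1 h).1).ne rfl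
  rw [blockCount, h1, Finset.card_insert_of_notMem h0, blockCount]
  split_ifs with h
  · obtain ⟨w, hw, rfl⟩ := h
    have h2 : T.filter (fun v => v + 1 ∉ T) =
        insert w (T.filter fun v => v + 1 ∉ T ∧ v + 1 ≠ w + 1) := by
      ext v
      simp only [Finset.mem_filter, Finset.mem_insert]
      constructor
      · rintro ⟨hv, hv'⟩
        by_cases hvw : v = w
        · exact Or.inl hvw
        · exact Or.inr ⟨hv, hv', by omega⟩
      · rintro (rfl | ⟨hv, hv', -⟩)
        · exact ⟨hw, fun hmem => (hlt _ hmem).ne rfl⟩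
        · exact ⟨hv, hv'⟩
    rw [h2, Finset.card_insert_of_notMem (by simp)]
  · have h2 : T.filter (fun v => v + 1 ∉ T ∧ v + 1 ≠ m) = T.filter fun v => v + 1 ∉ T :=
      Finset.filter_congr fun v hv =>
        ⟨fun hv' => hv'.1, fun hv' => ⟨hv', fun heq => h ⟨v, hv, heq⟩⟩⟩
    rw [h2]

theorem blockCount_pos {S : Finset ℕ} (hS : S.Nonempty) : 0 < blockCount S := by
  refine Finset.card_pos.2 ⟨S.max' hS, Finset.mem_filter.2 ⟨S.max'_mem hS, fun h => ?_⟩⟩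
  have := S.le_max' _ h
  omega

/-- The number of places `v < m` at which membership in `S` differs from membership of
the preceding integer, for `S ⊆ [0, m)`. -/
noncomputable def boundaryCount (m : ℕ) (S : Finset ℕ) : ℕ :=
  2 * blockCount S - if ∃ v ∈ S, v + 1 = m then 1 else 0

theorem boundaryCount_succ {m : ℕ} {T : Finset ℕ} (hT : T ⊆ Finset.range m) :
    boundaryCount (m + 1) T = 2 * blockCount T := by
  rw [boundaryCount, if_neg, Nat.sub_zero]
  rintro ⟨v, hv, hvm⟩
  have := Finset.mem_range.1 (hT hv)
  omega

theorem boundaryCount_succ_insert {m : ℕ} (T : Finset ℕ) :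
    boundaryCount (m + 1) (insert m T) = 2 * blockCount (insert m T) - 1 := by
  rw [boundaryCount, if_pos ⟨m, Finset.mem_insert_self _ _, rfl⟩]

theorem card_boundaryCount_eq (m j : ℕ) :
    ((Finset.range m).powerset.filter fun S => boundaryCount m S = j).card = m.choose j := by
  induction m generalizing j with
  | zero =>
    rcases j with _ | j
    · simp [boundaryCount, blockCount, Finset.filter_singleton]
    · simp [boundaryCount, blockCount, Finset.filter_singleton]
  | succ m ih =>
    have hstep : ∀ T ∈ (Finset.range m).powerset,
        (boundaryCount (m + 1) T = boundaryCount m T ∧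
          boundaryCount (m + 1) (insert m T) = boundaryCount m T + 1) ∨
        (boundaryCount (m + 1) T = boundaryCount m T + 1 ∧
          boundaryCount (m + 1) (insert m T) = boundaryCount m T) := by
      intro T hT
      rw [Finset.mem_powerset] at hT
      rw [boundaryCount_succ hT, boundaryCount_succ_insert, boundaryCount]
      have h1 := blockCount_insert hT
      split_ifs at h1 ⊢ with h
      · obtain ⟨w, hw, -⟩ := h
        have := blockCount_pos ⟨w, hw⟩
        omega
      · omega
    rw [Finset.card_filter, Finset.range_add_one,
      Finset.sum_powerset_insert Finset.notMem_range_self, ← Finset.sum_add_distrib]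
    rcases j with _ | j
    · rw [show (m + 1).choose 0 = m.choose 0 by simp, ← ih 0, Finset.card_filter]
      refine Finset.sum_congr rfl fun T hT => ?_
      have h2 := boundaryCount_succ_insert (m := m) T
      have h3 := blockCount_pos (Finset.insert_nonempty m T)
      rcases hstep T hT with ⟨h, h'⟩ | ⟨h, h'⟩ <;> split_ifs <;> omega
    · rw [Nat.choose_succ_succ, ← ih j, ← ih (j + 1), Finset.card_filter, Finset.card_filter,
        ← Finset.sum_add_distrib]
      refine Finset.sum_congr rfl fun T hT => ?_
      rcases hstep T hT with ⟨h, h'⟩ | ⟨h, h'⟩ <;> split_ifs <;> omega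

theorem card_blockCount_eq (m k : ℕ) :
    ((Finset.range m).powerset.filter fun S => blockCount S = k).card =
      (m + 1).choose (2 * k) := by
  rw [← card_boundaryCount_eq, Finset.card_filter, Finset.card_filter, Finset.range_add_one,
    Finset.sum_powerset_insert Finset.notMem_range_self, ← Finset.sum_add_distrib]
  refine Finset.sum_congr rfl fun T hT => ?_
  have h1 := boundaryCount_succ (Finset.mem_powerset.1 hT)
  have h2 := boundaryCount_succ_insert (m := m) T
  have h3 := blockCount_pos (Finset.insert_nonempty m T)
  split_ifs <;> omega

theorem blockCount_range (c : ℕ) : blockCount (Finset.range c) = if c = 0 then 0 else 1 := by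
  split_ifs with h
  · subst h
    simp [blockCount]
  · rw [blockCount, Finset.card_eq_one]
    refine ⟨c - 1, ?_⟩
    ext v
    simp only [Finset.mem_filter, Finset.mem_range, Finset.mem_singleton]
    omega

theorem card_one_descent_no_initialGaps (m : ℕ) :
    (Finset.univ.filter fun π : Equiv.Perm (Fin m) =>
        descentCount π = 1 ∧ initialGaps π = 0).card + m = (m + 1).choose 2 := by
  rw [card_descentCount_initialGaps, ← mul_one 2, ← card_blockCount_eq, zero_add]
  have hcard : ((Finset.Icc 1 m).image Finset.range).card = m := by
    rw [Finset.card_image_of_injective _ fun a b hab => by simpa using congrArg Finset.card hab,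
      Nat.card_Icc, Nat.add_sub_cancel]
  conv_lhs => enter [2]; rw [← hcard]
  rw [← Finset.card_union_of_disjoint]
  · congr 1
    ext S
    simp only [Finset.mem_union, Finset.mem_filter, Finset.mem_powerset, Finset.mem_image,
      Finset.mem_Icc]
    constructor
    · rintro (⟨h1, -, h2⟩ | ⟨c, hc, rfl⟩)
      · exact ⟨h1, h2⟩
      · refine ⟨Finset.range_subset_range.2 hc.2, ?_⟩
        rw [blockCount_range, if_neg (by omega)]
    · rintro ⟨h1, h2⟩
      by_cases h : ∃ c, S = Finset.range c
      · obtain ⟨c, rfl⟩ := h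
        rw [blockCount_range] at h2
        refine Or.inr ⟨c, ⟨?_, Finset.range_subset_range.1 h1⟩, rfl⟩
        split_ifs at h2
        omega
      · exact Or.inl ⟨h1, not_exists.1 h, h2⟩
  · rw [Finset.disjoint_left]
    intro S hS hS'
    obtain ⟨c, -, rfl⟩ := Finset.mem_image.1 hS'
    exact (Finset.mem_filter.1 hS).2.1 c rfl

theorem card_one_descent_initialGaps (m : ℕ) {j : ℕ} (hj : j ≠ 0) :
    (Finset.univ.filter fun π : Equiv.Perm (Fin m) =>
        descentCount π = 1 ∧ initialGaps π = j).card = (m + 1).choose (2 * (j + 1)) := by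
  rw [card_descentCount_initialGaps, ← card_blockCount_eq]
  congr 1
  refine Finset.filter_congr fun S _ => ⟨fun h => h.2, fun h => ⟨?_, h⟩⟩
  rintro c rfl
  rw [blockCount_range] at h
  split_ifs at h
  omega

theorem card_piAntidiag_univ_fin (n s : ℕ) :
    (Finset.piAntidiag (Finset.univ : Finset (Fin n)) s).card = n.multichoose s := by
  rw [← Finset.map_sym_eq_piAntidiag, Finset.card_map, Finset.sym_univ, Finset.card_univ,
    Sym.card_sym_eq_multichoose, Fintype.card_fin]

theorem ite_multichoose_sub {n : ℕ} (hn : 1 ≤ n) (t : ℕ) {k : ℕ} (hk : k < n) :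
    (if k ≤ t then n.multichoose (t - k) else 0) = (t + (n - 1) - k).choose (n - 1) := by
  split_ifs with h
  · rw [Nat.multichoose_eq, ← Nat.choose_symm (by omega)]
    congr 1 <;> omega
  · rw [Nat.choose_eq_zero_of_lt]
    omega

theorem card_piAntidiag_filter_odd {n : ℕ} (t : ℕ) (S : Finset (Fin n)) :
    ((Finset.piAntidiag (Finset.univ : Finset (Fin n)) (2 * t)).filter fun x =>
        (Finset.univ.filter fun i => Odd (x i)) = S).card =
      if Even S.card ∧ S.card ≤ 2 * t then n.multichoose (t - S.card / 2) else 0 := by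
  have hsum : ∀ y : Fin n → ℕ,
      ∑ i, (2 * y i + if i ∈ S then 1 else 0) = 2 * ∑ i, y i + S.card := by
    intro y
    rw [Finset.sum_add_distrib, ← Finset.mul_sum]
    simp
  have hhalf : ∀ x : Fin n → ℕ, (Finset.univ.filter fun i => Odd (x i)) = S →
      ∀ i, 2 * (x i / 2) + (if i ∈ S then 1 else 0) = x i := by
    rintro x rfl i
    simp only [Finset.mem_filter, Finset.mem_univ, true_and]
    split_ifs with h
    · exact Nat.two_mul_div_two_add_one_of_odd h
    · exact Nat.two_mul_div_two_of_even (Nat.not_odd_iff_even.1 h)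
  split_ifs with h
  · obtain ⟨⟨k, hk⟩, hle⟩ := h
    rw [← card_piAntidiag_univ_fin]
    symm
    refine Finset.card_nbij' (fun y i => 2 * y i + if i ∈ S then 1 else 0)
      (fun x i => x i / 2) ?_ ?_ ?_ ?_
    · intro y hy
      simp only [Finset.mem_coe, Finset.mem_piAntidiag, Finset.mem_univ, implies_true,
        and_true, Finset.mem_filter] at hy ⊢
      rw [hsum, hy]
      refine ⟨by omega, ?_⟩
      ext i
      simp only [Finset.mem_filter, Finset.mem_univ, true_and]
      split_ifs with hi <;> simp [hi, parity_simps]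
    · intro x hx
      simp only [Finset.mem_coe, Finset.mem_piAntidiag, Finset.mem_univ, implies_true,
        and_true, Finset.mem_filter] at hx ⊢
      have h1 := hsum fun i => x i / 2
      rw [Finset.sum_congr rfl fun i _ => hhalf x hx.2 i, hx.1] at h1
      omega
    · intro y _
      funext i
      dsimp only
      split_ifs <;> omega
    · intro x hx
      funext i
      exact hhalf x (Finset.mem_filter.1 hx).2 i
  · rw [Finset.card_eq_zero, Finset.filter_eq_empty_iff]
    intro x hx hS
    rw [Finset.mem_piAntidiag] at hx
    have h1 := hsum fun i => x i / 2
    rw [Finset.sum_congr rfl fun i _ => hhalf x hS i] at h1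
    have h2 : 2 * t = 2 * ∑ i, x i / 2 + S.card := hx.1.symm.trans h1
    exact h ⟨⟨t - ∑ i, x i / 2, by omega⟩, by omega⟩

theorem Finset.sum_range_two_mul {M : Type*} [AddCommMonoid M] (g : ℕ → M) (n : ℕ) :
    ∑ c ∈ Finset.range (2 * n), g c = ∑ k ∈ Finset.range n, (g (2 * k) + g (2 * k + 1)) := by
  induction n with
  | zero => simp
  | succ n ih =>
    rw [Finset.sum_range_succ, ← ih, show 2 * (n + 1) = 2 * n + 1 + 1 by ring,
      Finset.sum_range_succ, Finset.sum_range_succ, add_assoc]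

theorem multichoose_two_mul {n : ℕ} (hn : 1 ≤ n) (t : ℕ) :
    n.multichoose (2 * t) =
      ∑ k ∈ Finset.range n, n.choose (2 * k) * (t + (n - 1) - k).choose (n - 1) := by
  let φ : ℕ → ℕ := fun c => if Even c ∧ c ≤ 2 * t then n.multichoose (t - c / 2) else 0
  have h1 : n.multichoose (2 * t) =
      ∑ S ∈ (Finset.univ : Finset (Fin n)).powerset, φ S.card := by
    rw [← card_piAntidiag_univ_fin, Finset.card_eq_sum_card_fiberwise
      (f := fun x : Fin n → ℕ => Finset.univ.filter fun i => Odd (x i))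
      (t := (Finset.univ : Finset (Fin n)).powerset) (by intro x _; simp)]
    exact Finset.sum_congr rfl fun S _ => card_piAntidiag_filter_odd t S
  have h2 : ∑ c ∈ Finset.range (n + 1), n.choose c * φ c =
      ∑ c ∈ Finset.range (2 * n), n.choose c * φ c := by
    refine Finset.sum_subset (Finset.range_subset_range.2 (by omega)) fun c _ hc => ?_
    rw [Nat.choose_eq_zero_of_lt (by simpa using hc), zero_mul]
  rw [h1, Finset.sum_powerset_apply_card φ, Finset.card_univ, Fintype.card_fin]
  simp only [smul_eq_mul]
  rw [h2, Finset.sum_range_two_mul]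
  refine Finset.sum_congr rfl fun k hk => ?_
  rw [← ite_multichoose_sub hn t (Finset.mem_range.1 hk)]
  have h3 : φ (2 * k + 1) = 0 := if_neg (by simp [parity_simps])
  have h4 : φ (2 * k) = if k ≤ t then n.multichoose (t - k) else 0 := by
    simp [φ]
  rw [h3, h4, mul_zero, add_zero]

theorem card_piAntidiag_filter_lt {n : ℕ} (t : ℕ) (i : Fin n) :
    ((Finset.piAntidiag (Finset.univ : Finset (Fin n)) (2 * t)).filter fun x => t < x i).card =
      if 1 ≤ t then n.multichoose (t - 1) else 0 := by
  split_ifs with ht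
  · rw [← card_piAntidiag_univ_fin]
    symm
    have hsingle : ∑ j, (Pi.single i (t + 1) : Fin n → ℕ) j = t + 1 := by simp
    refine Finset.card_nbij' (fun y => y + Pi.single i (t + 1))
      (fun x => x - Pi.single i (t + 1)) ?_ ?_ ?_ ?_
    · intro y hy
      simp only [Finset.mem_coe, Finset.mem_piAntidiag, Finset.mem_univ, implies_true,
        and_true, Finset.mem_filter, Pi.add_apply, Pi.single_eq_same] at hy ⊢
      rw [Finset.sum_add_distrib, hsingle, hy]
      omega
    · intro x hx
      simp only [Finset.mem_coe, Finset.mem_piAntidiag, Finset.mem_univ, implies_true,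
        and_true, Finset.mem_filter, Pi.sub_apply] at hx ⊢
      have hle : ∀ j ∈ Finset.univ, (Pi.single i (t + 1) : Fin n → ℕ) j ≤ x j := by
        intro j _
        by_cases hj : j = i
        · subst hj
          simpa using hx.2
        · simp [hj]
      rw [Finset.sum_tsub_distrib _ hle, hsingle, hx.1]
      omega
    · intro y _
      simp
    · intro x hx
      refine tsub_add_cancel_of_le fun j => ?_
      by_cases hj : j = i
      · subst hj
        simpa using (Finset.mem_filter.1 hx).2
      · simp [hj]
  · rw [Finset.card_eq_zero, Finset.filter_eq_empty_iff]
    intro x hx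
    rw [Finset.mem_piAntidiag] at hx
    have h1 : x i ≤ Finset.univ.sum x :=
      Finset.single_le_sum (fun j _ => Nat.zero_le _) (Finset.mem_univ i)
    have h2 : Finset.univ.sum x = 2 * t := hx.1
    omega

theorem card_piAntidiag_filter_le {n : ℕ} (hn : 2 ≤ n) (t : ℕ) :
    ((Finset.piAntidiag (Finset.univ : Finset (Fin n)) (2 * t)).filter
        fun x => ∀ i, x i ≤ t).card + n * (t + (n - 1) - 1).choose (n - 1) =
      n.multichoose (2 * t) := by
  rw [← card_piAntidiag_univ_fin, ← Finset.card_filter_add_card_filter_not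
    (s := Finset.piAntidiag (Finset.univ : Finset (Fin n)) (2 * t)) (fun x => ∀ i, x i ≤ t)]
  congr 1
  have hunion : (Finset.piAntidiag (Finset.univ : Finset (Fin n)) (2 * t)).filter
      (fun x => ¬ ∀ i, x i ≤ t) = Finset.univ.biUnion fun i =>
        (Finset.piAntidiag (Finset.univ : Finset (Fin n)) (2 * t)).filter fun x => t < x i := by
    ext x
    simp only [Finset.mem_filter, Finset.mem_biUnion, Finset.mem_univ, true_and, not_forall,
      not_le, exists_and_left]
  rw [hunion, Finset.card_biUnion]
  · rw [Finset.sum_congr rfl fun i _ => card_piAntidiag_filter_lt t i,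
      ite_multichoose_sub (by omega) t (by omega)]
    simp
  · intro i _ j _ hij
    rw [Function.onFun, Finset.disjoint_left]
    intro x hx hx'
    simp only [Finset.mem_filter, Finset.mem_piAntidiag] at hx hx'
    have h1 : ∑ k ∈ {i, j}, x k ≤ Finset.univ.sum x :=
      Finset.sum_le_sum_of_subset (Finset.subset_univ _)
    rw [Finset.sum_pair hij] at h1
    omega

theorem hypersimplexTwo_subset (n : ℕ) :
    hypersimplexTwo n ⊆ {x | (∀ i, 0 ≤ x i ∧ x i ≤ 1) ∧ ∑ i, x i = 2} := by
  refine convexHull_min ?_ ?_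
  · rintro x ⟨B, hB, rfl⟩
    refine ⟨fun i => ?_, ?_⟩
    · unfold indVec
      split_ifs <;> simp
    · simp [indVec, hB]
  · rintro x ⟨hx, hxs⟩ y ⟨hy, hys⟩ a b ha hb hab
    refine ⟨fun i => ?_, ?_⟩
    · have := hx i
      have := hy i
      simp only [Pi.add_apply, Pi.smul_apply, smul_eq_mul]
      constructor <;> nlinarith
    · simp only [Pi.add_apply, Pi.smul_apply, smul_eq_mul, Finset.sum_add_distrib,
        ← Finset.mul_sum, hxs, hys]
      rw [← add_mul, hab, one_mul]

/-- A point of the `(t + 1)`-st dilate of the hypersimplex splits off a vertex. -/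
theorem exists_pair_sub_mem {n t : ℕ} (hn : 2 ≤ n) {x : Fin n → ℕ} (hx : ∀ i, x i ≤ t + 1)
    (hsum : ∑ i, x i = 2 * (t + 1)) :
    ∃ B : Finset (Fin n), B.card = 2 ∧ ∃ y : Fin n → ℕ, (∀ i, y i ≤ t) ∧ ∑ i, y i = 2 * t ∧
      ∀ i, x i = y i + if i ∈ B then 1 else 0 := by
  have : Nontrivial (Fin n) := Fin.nontrivial_iff_two_le.2 hn
  obtain ⟨i, -, hi⟩ := Finset.exists_max_image Finset.univ x Finset.univ_nonempty
  obtain ⟨k, hk⟩ := exists_ne i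
  obtain ⟨j, hj, hjmax⟩ := Finset.exists_max_image (Finset.univ.erase i) x
    ⟨k, Finset.mem_erase.2 ⟨hk, Finset.mem_univ k⟩⟩
  have hji : j ≠ i := Finset.ne_of_mem_erase hj
  have hi' : ∀ l, x l ≤ x i := fun l => hi l (Finset.mem_univ l)
  have hj' : ∀ l, l ≠ i → x l ≤ x j := fun l hl =>
    hjmax l (Finset.mem_erase.2 ⟨hl, Finset.mem_univ l⟩)
  have hjpos : 1 ≤ x j := by
    by_contra hlt
    have hs : ∑ l, x l = x i := Finset.sum_eq_single i
      (fun l _ hl => by have := hj' l hl; omega) (fun h => absurd (Finset.mem_univ i) h)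
    have := hx i
    omega
  have hpos : ∀ l, (if l ∈ ({i, j} : Finset (Fin n)) then 1 else 0) ≤ x l := by
    intro l
    split_ifs with hl
    · have := hi' j
      rcases Finset.mem_insert.1 hl with rfl | hl
      · omega
      · rw [Finset.mem_singleton.1 hl]
        exact hjpos
    · exact Nat.zero_le _
  refine ⟨{i, j}, Finset.card_pair hji.symm,
    fun l => x l - if l ∈ ({i, j} : Finset (Fin n)) then 1 else 0, fun l => ?_, ?_, fun l => ?_⟩
  · dsimp only
    split_ifs with hl
    · have := hx l
      omega
    · simp only [Finset.mem_insert, Finset.mem_singleton, not_or] at hl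
      by_contra hlt
      have h1 : ∑ r ∈ {i, j, l}, x r ≤ ∑ r, x r :=
        Finset.sum_le_sum_of_subset (Finset.subset_univ _)
      rw [Finset.sum_insert (by simp [hji.symm, Ne.symm hl.1]),
        Finset.sum_pair (Ne.symm hl.2)] at h1
      have := hj' l hl.1
      have := hi' l
      omega
  · rw [Finset.sum_tsub_distrib _ fun l _ => hpos l, hsum]
    simp only [Finset.sum_ite_mem, Finset.univ_inter, Finset.sum_const, smul_eq_mul, mul_one,
      Finset.card_pair hji.symm]
    omega
  · exact (Nat.sub_add_cancel (hpos l)).symm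

theorem natCast_mem_smul_hypersimplexTwo {n t : ℕ} (hn : 2 ≤ n) {x : Fin n → ℕ}
    (hx : ∀ i, x i ≤ t) (hsum : ∑ i, x i = 2 * t) :
    (fun i => (x i : ℝ)) ∈ (t : ℝ) • hypersimplexTwo n := by
  induction t generalizing x with
  | zero =>
    have hne : (hypersimplexTwo n).Nonempty := by
      obtain ⟨B, -, hB⟩ := Finset.exists_subset_card_eq
        (s := (Finset.univ : Finset (Fin n))) (n := 2) (by simpa using hn)
      exact ⟨indVec B, subset_convexHull ℝ _ ⟨B, hB, rfl⟩⟩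
    rw [Nat.cast_zero, Set.zero_smul_set hne, Set.mem_zero]
    funext i
    simpa using hx i
  | succ t ih =>
    obtain ⟨B, hB, y, hy, hys, hxy⟩ := exists_pair_sub_mem hn hx hsum
    have hconv : Convex ℝ (hypersimplexTwo n) := convex_convexHull ℝ _
    rw [Nat.cast_succ, hconv.add_smul t.cast_nonneg zero_le_one, one_smul]
    refine ⟨_, ih hy hys, indVec B, subset_convexHull ℝ _ ⟨B, hB, rfl⟩, ?_⟩
    funext i
    simp [hxy i, indVec]

theorem latticeCount_smul_hypersimplexTwo {n : ℕ} (hn : 2 ≤ n) (t : ℕ) :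
    latticeCount ((t : ℝ) • hypersimplexTwo n) =
      ((Finset.piAntidiag (Finset.univ : Finset (Fin n)) (2 * t)).filter
        fun x => ∀ i, x i ≤ t).card := by
  have hinj : Function.Injective fun (x : Fin n → ℕ) (i : Fin n) => (x i : ℝ) := by
    intro x y hxy
    funext i
    exact Nat.cast_injective (congrFun hxy i)
  rw [latticeCount, ← Set.ncard_coe_finset, ← Set.ncard_image_of_injective _ hinj]
  congr 1
  ext x
  simp only [Set.mem_ofPred_eq, Set.mem_image, Finset.mem_coe, Finset.mem_filter,
    Finset.mem_piAntidiag, Finset.mem_univ, implies_true, and_true]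
  constructor
  · rintro ⟨⟨z, hz, rfl⟩, h_int⟩
    obtain ⟨hz, hzs⟩ := hypersimplexTwo_subset n hz
    choose m hm using h_int
    simp only [Pi.smul_apply, smul_eq_mul] at hm
    have ht : (0 : ℝ) ≤ t := t.cast_nonneg
    have hm0 : ∀ i, 0 ≤ m i := fun i => by
      have : (0 : ℝ) ≤ m i := by
        rw [← hm]
        exact mul_nonneg ht (hz i).1
      exact_mod_cast this
    have hcast : ∀ i, ((m i).toNat : ℝ) = t * z i := fun i => by
      rw [hm i]
      exact_mod_cast Int.toNat_of_nonneg (hm0 i)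
    refine ⟨fun i => (m i).toNat, ⟨?_, fun i => ?_⟩, ?_⟩
    · have : ((∑ i, (m i).toNat : ℕ) : ℝ) = (2 * t : ℕ) := by
        push_cast
        simp only [hcast]
        rw [← Finset.mul_sum, hzs, mul_comm]
      exact_mod_cast this
    · have : ((m i).toNat : ℝ) ≤ t := by
        rw [hcast]
        exact mul_le_of_le_one_right ht (hz i).2
      exact_mod_cast this
    · funext i
      simp [hcast]
  · rintro ⟨y, ⟨hys, hy⟩, rfl⟩
    exact ⟨natCast_mem_smul_hypersimplexTwo hn hy hys, fun i => ⟨y i, by simp⟩⟩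

theorem eq_of_sum_mul_choose_eq {d : ℕ} {a b : ℕ → ℕ}
    (h : ∀ t, ∑ k ∈ Finset.range (d + 1), a k * (t + d - k).choose d =
      ∑ k ∈ Finset.range (d + 1), b k * (t + d - k).choose d) {k : ℕ} (hk : k ≤ d) :
    a k = b k := by
  induction k using Nat.strong_induction_on with
  | _ k ih =>
    have htrunc : ∀ c : ℕ → ℕ, ∑ i ∈ Finset.range (d + 1), c i * (k + d - i).choose d =
        ∑ i ∈ Finset.range k, c i * (k + d - i).choose d + c k := by
      intro c
      rw [← Finset.sum_subset (Finset.range_subset_range.2 (show k + 1 ≤ d + 1 by omega)),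
        Finset.sum_range_succ, Nat.add_sub_cancel_left, Nat.choose_self, mul_one]
      intro i hi hik
      rw [Finset.mem_range] at hi hik
      rw [Nat.choose_eq_zero_of_lt (by omega), mul_zero]
    have hk' := h k
    rw [htrunc, htrunc, Finset.sum_congr rfl fun i hi => by
      rw [ih i (Finset.mem_range.1 hi) (by have := Finset.mem_range.1 hi; omega)]] at hk'
    exact Nat.add_left_cancel hk'

theorem IsHStarVector.add_ite_eq_choose {n : ℕ} (hn : 2 ≤ n) {h : ℕ → ℕ}
    (hh : IsHStarVector (hypersimplexTwo n) (n - 1) h) (k : ℕ) :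
    h k + (if k = 1 then n else 0) = n.choose (2 * k) := by
  rcases lt_or_ge (n - 1) k with hk | hk
  · rw [hh.2 k hk, if_neg (by omega), Nat.choose_eq_zero_of_lt (by omega)]
  · refine eq_of_sum_mul_choose_eq (d := n - 1) (a := fun k => h k + if k = 1 then n else 0)
      (b := fun k => n.choose (2 * k)) (fun t => ?_) hk
    have h1 := hh.1 t
    have h2 := card_piAntidiag_filter_le hn t
    have h3 := multichoose_two_mul (show 1 ≤ n by omega) t
    rw [← latticeCount_smul_hypersimplexTwo hn, h1, h3] at h2
    rw [Nat.sub_add_cancel (show 1 ≤ n by omega)] at h2 ⊢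
    rw [← h2]
    simp only [add_mul, Finset.sum_add_distrib, ite_mul, zero_mul]
    rw [Finset.sum_ite_eq', if_pos (Finset.mem_range.2 (by omega))]

theorem IsHStarVector.eq_zero_of_lt_two {n : ℕ} (hn : n < 2) {h : ℕ → ℕ}
    (hh : IsHStarVector (hypersimplexTwo n) (n - 1) h) (k : ℕ) : h k = 0 := by
  rcases Nat.eq_zero_or_pos k with rfl | hk
  · have hempty : hypersimplexTwo n = ∅ := by
      rw [hypersimplexTwo, convexHull_eq_empty, Set.eq_empty_iff_forall_notMem]
      rintro x ⟨B, hB, -⟩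
      have := B.card_le_univ
      rw [Fintype.card_fin] at this
      omega
    have h0 := hh.1 0
    rw [hempty, show n - 1 = 0 by omega] at h0
    simpa [latticeCount] using h0.symm
  · exact hh.2 k (by omega)

/-- For the matroid polytope `P` of `U_{2,n}`, the `h*`-vector
satisfies `h*₀ + h*₁ = #{π ∈ P_{1,n-1} : ig(π) = 0}` and, for every `k ≥ 2`,
`h*_k = #{π ∈ P_{1,n-1} : ig(π) = k - 1}`. -/
theorem hstar_hypersimplex_two_initial_gaps (n : ℕ) (h : ℕ → ℕ)
    (hh : IsHStarVector (hypersimplexTwo n) (n - 1) h) :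
    (h 0 + h 1 = (Finset.univ.filter fun π : Equiv.Perm (Fin (n - 1)) =>
        descentCount π = 1 ∧ initialGaps π = 0).card) ∧
    ∀ k : ℕ, 2 ≤ k →
      h k = (Finset.univ.filter fun π : Equiv.Perm (Fin (n - 1)) =>
        descentCount π = 1 ∧ initialGaps π = k - 1).card := by
  rcases lt_or_ge n 2 with hn | hn
  · have hzero := hh.eq_zero_of_lt_two hn
    have hm : n - 1 = 0 := by omega
    have hdesc : ∀ π : Equiv.Perm (Fin (n - 1)), descentCount π ≠ 1 := by
      intro π
      simp [descentCount, hm]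
    simp [hzero, hdesc]
  · have hchoose := hh.add_ite_eq_choose hn
    refine ⟨?_, fun k hk => ?_⟩
    · have h0 := hchoose 0
      have h1 := hchoose 1
      have h2 := card_one_descent_no_initialGaps (n - 1)
      rw [Nat.sub_add_cancel (by omega)] at h2
      simp only [mul_zero, Nat.choose_zero_right, zero_ne_one, if_false, if_true,
        mul_one] at h0 h1
      omega
    · rw [card_one_descent_initialGaps _ (by omega), Nat.sub_add_cancel (by omega),
        Nat.sub_add_cancel (by omega), ← hchoose k, if_neg (by omega), add_zero]
end
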